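/- If x ∈ S_n is a maximal singular point (MSP) for w ∈ S_n, then the flattened permutation x̃ avoids the pattern 1234. -/

import Mathlib

open scoped Classical

namespace BSW

/-- The number of inversions (the length) of a permutation of `Fin n`. -/
def invLen {n : ℕ} (w : Equiv.Perm (Fin n)) : ℕ :=
  (Finset.univ.filter (fun p : Fin n × Fin n => p.1 < p.2 ∧ w p.2 < w p.1)).card

/-- The rank function `r_w(p,q) = #{i : 1 ≤ i ≤ p and w(i) ≥ q}`, where the
permutation of `Fin n` is regarded as a permutation of `{1,…,n}` (so position
`i : Fin n` corresponds to `i+1` and value `w i` to `(w i)+1`). -/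
def rank {n : ℕ} (w : Equiv.Perm (Fin n)) (p q : ℤ) : ℕ :=
  (Finset.univ.filter (fun i : Fin n =>
    ((i : ℕ) : ℤ) + 1 ≤ p ∧ q ≤ ((w i : ℕ) : ℤ) + 1)).card

/-- The difference function `d_{x,w}(p,q) = r_w(p,q) − r_x(p,q)`. -/
def dxw {n : ℕ} (x w : Equiv.Perm (Fin n)) (p q : ℤ) : ℤ :=
  (rank w p q : ℤ) - (rank x p q : ℤ)

/-- The Bruhat order: `x ≤ w` iff `d_{x,w}` is everywhere non-negative. -/
def bruhatLE {n : ℕ} (x w : Equiv.Perm (Fin n)) : Prop :=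
  ∀ p q : ℤ, 0 ≤ dxw x w p q

/-- The set of transpositions in `S_n`. -/
def transpositions (n : ℕ) : Set (Equiv.Perm (Fin n)) :=
  {t | ∃ a b : Fin n, a ≠ b ∧ t = Equiv.swap a b}

/-- `R(x,w) = {t ∈ T : l(xt) > l(x) and xt ≤ w}`. -/
def R {n : ℕ} (x w : Equiv.Perm (Fin n)) : Set (Equiv.Perm (Fin n)) :=
  {t | t ∈ transpositions n ∧ invLen x < invLen (x * t) ∧ bruhatLE (x * t) w}

/-- `x` is a maximal singular point (MSP) for `w`. -/
def MSP {n : ℕ} (x w : Equiv.Perm (Fin n)) : Prop :=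
  bruhatLE x w ∧ ((invLen w : ℤ) - (invLen x : ℤ) < ((R x w).ncard : ℤ)) ∧
    ∀ t ∈ R x w, ((R (x * t) w).ncard : ℤ) = (invLen w : ℤ) - (invLen (x * t) : ℤ)

/-- `Δ(x,w) = {i : t_{{i,j}} ∈ R(x,w) for some j}`. -/
def Delta {n : ℕ} (x w : Equiv.Perm (Fin n)) : Set (Fin n) :=
  {i | ∃ j : Fin n, Equiv.swap i j ∈ R x w}

/-- `Δ(x,w)` as a finset. -/
noncomputable def DeltaFinset {n : ℕ} (x w : Equiv.Perm (Fin n)) : Finset (Fin n) :=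
  (Set.toFinite (Delta x w)).toFinset

/-- `σ ∈ S_k` is the flattening of `x` along the increasing enumeration `d_1 < … < d_k`
of a set `D` of positions with `#D = k`: the unique permutation of `{1,…,k}` with
`σ(a) < σ(b)` iff `x(d_a) < x(d_b)`. -/
def IsFlatteningOn {n k : ℕ} (x : Equiv.Perm (Fin n)) (D : Finset (Fin n))
    (hD : D.card = k) (σ : Equiv.Perm (Fin k)) : Prop :=
  ∀ a b : Fin k, σ a < σ b ↔ x ((D.orderIsoOfFin hD a : Fin n)) < x ((D.orderIsoOfFin hD b : Fin n))

/-- Values (0-indexed) of the permutation `x_{k,m} = [k,…,1, k+m,…,k+1]`. -/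
def xkmVal (k m i : ℕ) : ℕ :=
  if i < k then k - 1 - i else 2 * k + m - 1 - i

/-- Values (0-indexed) of the permutation `w_{k,m} = [k+m, k,…,2, k+m−1,…,k+1, 1]`. -/
def wkmVal (k m i : ℕ) : ℕ :=
  if i = 0 then k + m - 1
  else if i < k then k - i
  else if i < k + m - 1 then 2 * k + m - 2 - i
  else 0

/-- Values (0-indexed) of the permutation `x_{k,l,m} = [k,…,1, k+l,…,k+1, k+l+m,…,k+l+1]`. -/
def xklmVal (k l m i : ℕ) : ℕ :=
  if i < k then k - 1 - i
  else if i < k + l then 2 * k + l - 1 - i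
  else 2 * (k + l) + m - 1 - i

/-- Values (0-indexed) of the permutation
`w_{k,l,m} = [k+l, k,…,2, k+l+m, k+l−1,…,k+2, 1, k+l+m−1,…,k+l+1, k+1]`. -/
def wklmVal (k l m i : ℕ) : ℕ :=
  if i = 0 then k + l - 1
  else if i < k then k - i
  else if i = k then k + l + m - 1
  else if i < k + l - 1 then 2 * k + l - 1 - i
  else if i = k + l - 1 then 0
  else if i < k + l + m - 1 then 2 * (k + l) + m - 2 - i
  else k

/-- The half-open box of lattice cells spanned by `A` (south-west) and `B` (north-east). -/
def InBox (A B : ℤ × ℤ) (p q : ℤ) : Prop :=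
  A.1 ≤ p ∧ p < B.1 ∧ A.2 ≤ q ∧ q < B.2

/-- `A` lies south-west of `B`, and `D` is positive on the box spanned by them. -/
def Edge (D : ℤ → ℤ → ℤ) (A B : ℤ × ℤ) : Prop :=
  A.1 < B.1 ∧ A.2 < B.2 ∧ ∀ p q, InBox A B p q → 1 ≤ D p q

/-- Two boxes without a common corner overlap in a cell where `D ≤ 1`. -/
def Patch (D : ℤ → ℤ → ℤ) (A B C E : ℤ × ℤ) : Prop :=
  A ≠ C ∧ B ≠ E ∧ ∃ p q, InBox A B p q ∧ InBox C E p q ∧ D p q ≤ 1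

/-- For a chain `C, A, B`, both off-diagonal corner boxes contain a zero of `D`. -/
def Link (D : ℤ → ℤ → ℤ) (C A B : ℤ × ℤ) : Prop :=
  (∃ p q, InBox (C.1, A.2) (A.1, B.2) p q ∧ D p q ≤ 0) ∧
    ∃ p q, InBox (A.1, C.2) (B.1, A.2) p q ∧ D p q ≤ 0

/-- Incompatibility of the edges `(A, B)` and `(C, E)`. -/
def Incomp (D : ℤ → ℤ → ℤ) (A B C E : ℤ × ℤ) : Prop :=
  Patch D A B C E ∨ (B = C ∧ Link D A B E) ∨ (E = A ∧ Link D C A B)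

/-- `D` decreased by one on the box spanned by `A` and `B`. -/
noncomputable def lower (D : ℤ → ℤ → ℤ) (A B : ℤ × ℤ) (p q : ℤ) : ℤ :=
  D p q - if InBox A B p q then 1 else 0

/-- The point set `S` after exchanging the second coordinates of `A` and `B`. -/
def swapPts (S : Set (ℤ × ℤ)) (A B : ℤ × ℤ) : Set (ℤ × ℤ) :=
  {P | (P ∈ S ∧ P ≠ A ∧ P ≠ B) ∨ P = (A.1, B.2) ∨ P = (B.1, A.2)}

/-- The edges on `S` which are incompatible with `(A, B)`. -/
def incompEdges (S : Set (ℤ × ℤ)) (D : ℤ → ℤ → ℤ) (A B : ℤ × ℤ) :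
    Set ((ℤ × ℤ) × (ℤ × ℤ)) :=
  {T | T.1 ∈ S ∧ T.2 ∈ S ∧ Edge D T.1 T.2 ∧ Incomp D A B T.1 T.2}

/-- The geometric content of being a maximal singular point, in a form which is invariant
under transposition and half-turn of the plane. -/
structure IsMaxSing (S : Set (ℤ × ℤ)) (D : ℤ → ℤ → ℤ) : Prop where
  fin : S.Finite
  inj_fst : ∀ A ∈ S, ∀ B ∈ S, A.1 = B.1 → A = B
  inj_snd : ∀ A ∈ S, ∀ B ∈ S, A.2 = B.2 → A = B
  nonneg : ∀ p q, 0 ≤ D p q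
  regular : ∃ e : ℕ, 0 < e ∧ ∀ A ∈ S, ∀ B ∈ S, Edge D A B → (incompEdges S D A B).ncard = e
  compat : ∀ A ∈ S, ∀ B ∈ S, Edge D A B →
    ∀ C ∈ swapPts S A B, ∀ E ∈ swapPts S A B, ∀ F ∈ swapPts S A B, ∀ G ∈ swapPts S A B,
      Edge (lower D A B) C E → Edge (lower D A B) F G → ¬ Incomp (lower D A B) C E F G
  box : ∀ p₁ p₂ q₁ q₂, p₁ ≤ p₂ → q₁ ≤ q₂ →
    -(({P ∈ S | p₁ < P.1 ∧ P.1 ≤ p₂ ∧ q₁ < P.2 ∧ P.2 ≤ q₂}.ncard : ℕ) : ℤ) ≤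
      D p₂ q₁ - D p₁ q₁ - D p₂ q₂ + D p₁ q₂

lemma lower_le (D : ℤ → ℤ → ℤ) (A B : ℤ × ℤ) (p q : ℤ) : lower D A B p q ≤ D p q := by
  unfold lower; split <;> omega

lemma Incomp.symm {D : ℤ → ℤ → ℤ} {A B C E : ℤ × ℤ} (h : Incomp D A B C E) :
    Incomp D C E A B := by
  rcases h with ⟨h1, h2, p, q, h3, h4, h5⟩ | ⟨rfl, h⟩ | ⟨rfl, h⟩
  · exact Or.inl ⟨h1.symm, h2.symm, p, q, h4, h3, h5⟩
  · exact Or.inr (Or.inr ⟨rfl, h⟩)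
  · exact Or.inr (Or.inl ⟨rfl, h⟩)

/-- An edge that survives lowering `D` on the box of `A` and `B`. -/
def EdgeOff (D : ℤ → ℤ → ℤ) (A B C E : ℤ × ℤ) : Prop :=
  C.1 < E.1 ∧ C.2 < E.2 ∧ ∀ p q, InBox C E p q → 1 ≤ D p q ∧ (InBox A B p q → 2 ≤ D p q)

lemma EdgeOff.edge {D : ℤ → ℤ → ℤ} {A B C E : ℤ × ℤ} (h : EdgeOff D A B C E) :
    Edge (lower D A B) C E := by
  refine ⟨h.1, h.2.1, fun p q hpq => ?_⟩
  have := h.2.2 p q hpq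
  unfold lower
  split <;> grind

section Plane

variable {S : Set (ℤ × ℤ)} {D : ℤ → ℤ → ℤ}

namespace IsMaxSing

lemma no_patch (H : IsMaxSing S D) {A B C E F G : ℤ × ℤ} (hA : A ∈ S) (hB : B ∈ S)
    (hAB : Edge D A B) (hC : C ∈ swapPts S A B) (hE : E ∈ swapPts S A B)
    (hF : F ∈ swapPts S A B) (hG : G ∈ swapPts S A B) (hCE : EdgeOff D A B C E)
    (hFG : EdgeOff D A B F G) (h : Patch D C E F G) : False := by
  obtain ⟨h1, h2, p, q, h3, h4, h5⟩ := h
  exact H.compat A hA B hB hAB C hC E hE F hF G hG hCE.edge hFG.edge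
    (Or.inl ⟨h1, h2, p, q, h3, h4, (lower_le D A B p q).trans h5⟩)

lemma no_link (H : IsMaxSing S D) {A B C E F : ℤ × ℤ} (hA : A ∈ S) (hB : B ∈ S)
    (hAB : Edge D A B) (hC : C ∈ swapPts S A B) (hE : E ∈ swapPts S A B)
    (hF : F ∈ swapPts S A B) (hCE : EdgeOff D A B C E)
    (hEF : EdgeOff D A B E F) (h : Link D C E F) : False := by
  obtain ⟨⟨p, q, h1, h2⟩, p', q', h3, h4⟩ := h
  exact H.compat A hA B hB hAB C hC E hE E hE F hF hCE.edge hEF.edge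
    (Or.inr (Or.inl ⟨rfl, ⟨p, q, h1, (lower_le D A B p q).trans h2⟩,
      p', q', h3, (lower_le D A B p' q').trans h4⟩))

/-- The lower one of two linked edges has no point of `S` in its interior. -/
lemma link_cover_lower (H : IsMaxSing S D) {C A B I : ℤ × ℤ} (hC : C ∈ S) (hA : A ∈ S)
    (hB : B ∈ S) (hI : I ∈ S) (hCA : Edge D C A) (hAB : Edge D A B) (hl : Link D C A B)
    (h1 : C.1 < I.1) (h2 : C.2 < I.2) (h3 : I.1 < A.1) (h4 : I.2 < A.2) : False := by
  obtain ⟨c1, c2⟩ := C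
  obtain ⟨a1, a2⟩ := A
  obtain ⟨b1, b2⟩ := B
  obtain ⟨i1, i2⟩ := I
  obtain ⟨⟨p, q, hz, hz0⟩, p', q', hz', hz0'⟩ := hl
  have hCI : Edge D (c1, c2) (i1, i2) := by grind [Edge, InBox]
  have hIA : Edge D (i1, i2) (a1, a2) := by grind [Edge, InBox]
  by_cases k1 : ∃ p q, InBox (i1, a2) (a1, b2) p q ∧ D p q ≤ 0
  · obtain ⟨p, q, hz, hz0⟩ := k1
    refine H.no_link hC hI hCI (C := (i1, c2)) (E := (a1, a2)) (F := (b1, b2)) ?_ ?_ ?_ ?_ ?_ ?_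
    · simp [swapPts]
    · grind [swapPts, Edge]
    · grind [swapPts, Edge]
    · grind [EdgeOff, Edge, InBox]
    · grind [EdgeOff, Edge, InBox]
    · exact ⟨⟨p, q, by grind [InBox], hz0⟩, p', q', by grind [InBox], hz0'⟩
  by_cases k2 : ∃ p q, InBox (a1, i2) (b1, a2) p q ∧ D p q ≤ 0
  · obtain ⟨p', q', hz', hz0'⟩ := k2
    refine H.no_link hC hI hCI (C := (c1, i2)) (E := (a1, a2)) (F := (b1, b2)) ?_ ?_ ?_ ?_ ?_ ?_
    · simp [swapPts]
    · grind [swapPts, Edge]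
    · grind [swapPts, Edge]
    · grind [EdgeOff, Edge, InBox]
    · grind [EdgeOff, Edge, InBox]
    · exact ⟨⟨p, q, by grind [InBox], hz0⟩, p', q', by grind [InBox], hz0'⟩
  push Not at k1 k2
  refine H.no_link hI hA hIA (C := (c1, c2)) (E := (i1, a2)) (F := (b1, b2)) ?_ ?_ ?_ ?_ ?_ ?_
  · grind [swapPts, Edge]
  · simp [swapPts]
  · grind [swapPts, Edge]
  · grind [EdgeOff, Edge, InBox]
  · grind [EdgeOff, Edge, InBox]
  · exact ⟨⟨p, q, by grind [InBox], hz0⟩, p', q', by grind [InBox], hz0'⟩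

/-- The upper one of two linked edges has no point of `S` in its interior. -/
lemma link_cover_upper (H : IsMaxSing S D) {C A B I : ℤ × ℤ} (hC : C ∈ S) (hA : A ∈ S)
    (hB : B ∈ S) (hI : I ∈ S) (hCA : Edge D C A) (hAB : Edge D A B) (hl : Link D C A B)
    (h1 : A.1 < I.1) (h2 : A.2 < I.2) (h3 : I.1 < B.1) (h4 : I.2 < B.2) : False := by
  obtain ⟨c1, c2⟩ := C
  obtain ⟨a1, a2⟩ := A
  obtain ⟨b1, b2⟩ := B
  obtain ⟨i1, i2⟩ := I
  obtain ⟨⟨p, q, hz, hz0⟩, p', q', hz', hz0'⟩ := hl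
  have hAI : Edge D (a1, a2) (i1, i2) := by grind [Edge, InBox]
  have hIB : Edge D (i1, i2) (b1, b2) := by grind [Edge, InBox]
  by_cases k1 : ∃ p q, InBox (c1, a2) (a1, i2) p q ∧ D p q ≤ 0
  · obtain ⟨p, q, hz, hz0⟩ := k1
    refine H.no_link hI hB hIB (C := (c1, c2)) (E := (a1, a2)) (F := (b1, i2)) ?_ ?_ ?_ ?_ ?_ ?_
    · grind [swapPts, Edge]
    · grind [swapPts, Edge]
    · simp [swapPts]
    · grind [EdgeOff, Edge, InBox]
    · grind [EdgeOff, Edge, InBox]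
    · exact ⟨⟨p, q, by grind [InBox], hz0⟩, p', q', by grind [InBox], hz0'⟩
  by_cases k2 : ∃ p q, InBox (a1, c2) (i1, a2) p q ∧ D p q ≤ 0
  · obtain ⟨p', q', hz', hz0'⟩ := k2
    refine H.no_link hI hB hIB (C := (c1, c2)) (E := (a1, a2)) (F := (i1, b2)) ?_ ?_ ?_ ?_ ?_ ?_
    · grind [swapPts, Edge]
    · grind [swapPts, Edge]
    · simp [swapPts]
    · grind [EdgeOff, Edge, InBox]
    · grind [EdgeOff, Edge, InBox]
    · exact ⟨⟨p, q, by grind [InBox], hz0⟩, p', q', by grind [InBox], hz0'⟩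
  push Not at k1 k2
  refine H.no_link hA hI hAI (C := (c1, c2)) (E := (a1, i2)) (F := (b1, b2)) ?_ ?_ ?_ ?_ ?_ ?_
  · grind [swapPts, Edge]
  · simp [swapPts]
  · grind [swapPts, Edge]
  · grind [EdgeOff, Edge, InBox]
  · grind [EdgeOff, Edge, InBox]
  · exact ⟨⟨p, q, by grind [InBox], hz0⟩, p', q', by grind [InBox], hz0'⟩

/-- A patch of `(C, E)` and `(F, G)` persists after exchanging `A` and `B`, provided `(A, B)` is
far from `(F, G)` and is compatible with `(C, E)`. -/
lemma patch_persists (H : IsMaxSing S D) {A B C E F G : ℤ × ℤ} (hA : A ∈ S) (hB : B ∈ S)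
    (hC : C ∈ S) (hE : E ∈ S) (hF : F ∈ S) (hG : G ∈ S)
    (hAB : Edge D A B) (hCE : Edge D C E) (hFG : Edge D F G) (hP : Patch D C E F G)
    (hFA : F ≠ A) (hFB : F ≠ B) (hGA : G ≠ A) (hGB : G ≠ B)
    (hdisj : ∀ p q, InBox A B p q → ¬ InBox F G p q)
    (hinc : ¬ Incomp D A B C E) (hl : C = A → B.1 < E.1 ∨ B.2 < E.2)
    (hu : E = B → C.1 < A.1 ∨ C.2 < A.2) : False := by
  obtain ⟨n1, n2, p, q, hz1, hz2, hz0⟩ := hP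
  have hoff : EdgeOff D A B F G := ⟨hFG.1, hFG.2.1, fun p q h =>
    ⟨hFG.2.2 p q h, fun h' => absurd h (hdisj p q h')⟩⟩
  have hz3 : ¬ InBox A B p q := fun h => hdisj p q h hz2
  have hF' : F ∈ swapPts S A B := Or.inl ⟨hF, hFA, hFB⟩
  have hG' : G ∈ swapPts S A B := Or.inl ⟨hG, hGA, hGB⟩
  have key : ∀ C' ∈ swapPts S A B, ∀ E' ∈ swapPts S A B, EdgeOff D A B C' E' → C' ≠ F →
      E' ≠ G → InBox C' E' p q → False := fun C' hC' E' hE' ho h1 h2 h3 =>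
    H.no_patch hA hB hAB hC' hE' hF' hG' ho hoff ⟨h1, h2, p, q, h3, hz2, hz0⟩
  have hQ1 : (A.1, B.2) ∈ swapPts S A B := by simp [swapPts]
  have hQ2 : (B.1, A.2) ∈ swapPts S A B := by simp [swapPts]
  have hF1 : (A.1, B.2) ≠ F := fun h => hFA (H.inj_fst F hF A hA (by rw [← h]))
  have hF2 : (B.1, A.2) ≠ F := fun h => hFB (H.inj_fst F hF B hB (by rw [← h]))
  have hG1 : (A.1, B.2) ≠ G := fun h => hGA (H.inj_fst G hG A hA (by rw [← h]))
  have hG2 : (B.1, A.2) ≠ G := fun h => hGB (H.inj_fst G hG B hB (by rw [← h]))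
  have d1 := H.inj_fst
  have d2 := H.inj_snd
  by_cases c1 : C = A
  · subst c1
    by_cases c2 : E = B
    · grind
    have hE' : E ∈ swapPts S C B := by grind [swapPts, Edge]
    have e1 := d1 E hE B hB
    have e2 := d2 E hE B hB
    by_cases c3 : B.2 ≤ q
    · exact key _ hQ1 _ hE' (by grind [EdgeOff, Edge, InBox]) hF1 n2 (by grind [InBox])
    · exact key _ hQ2 _ hE' (by grind [EdgeOff, Edge, InBox]) hF2 n2 (by grind [InBox])
  by_cases c2 : E = B
  · subst c2
    have hC' : C ∈ swapPts S A E := by grind [swapPts, Edge]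
    have e1 := d1 C hC A hA
    have e2 := d2 C hC A hA
    by_cases c3 : p < A.1
    · exact key _ hC' _ hQ1 (by grind [EdgeOff, Edge, InBox]) n1 hG1 (by grind [InBox])
    · exact key _ hC' _ hQ2 (by grind [EdgeOff, Edge, InBox]) n1 hG2 (by grind [InBox])
  by_cases c3 : C = B
  · subst c3
    have hE' : E ∈ swapPts S A C := by grind [swapPts, Edge]
    have hn : ¬ Link D A C E := fun h => hinc (Or.inr (Or.inl ⟨rfl, h⟩))
    by_cases c4 : ∃ p q, InBox (A.1, C.2) (C.1, E.2) p q ∧ D p q ≤ 0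
    · have c5 : ∀ p q, InBox (C.1, A.2) (E.1, C.2) p q → ¬ D p q ≤ 0 :=
        fun p q h h' => hn ⟨c4, p, q, h, h'⟩
      exact key _ hQ2 _ hE' (by grind [EdgeOff, Edge, InBox]) hF2 n2 (by grind [InBox, Edge])
    · push Not at c4
      exact key _ hQ1 _ hE' (by grind [EdgeOff, Edge, InBox]) hF1 n2 (by grind [InBox, Edge])
  by_cases c4 : E = A
  · subst c4
    have hC' : C ∈ swapPts S E B := by grind [swapPts, Edge]
    have hn : ¬ Link D C E B := fun h => hinc (Or.inr (Or.inr ⟨rfl, h⟩))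
    by_cases c4 : ∃ p q, InBox (C.1, E.2) (E.1, B.2) p q ∧ D p q ≤ 0
    · have c5 : ∀ p q, InBox (E.1, C.2) (B.1, E.2) p q → ¬ D p q ≤ 0 :=
        fun p q h h' => hn ⟨c4, p, q, h, h'⟩
      exact key _ hC' _ hQ2 (by grind [EdgeOff, Edge, InBox]) n1 hG2 (by grind [InBox, Edge])
    · push Not at c4
      exact key _ hC' _ hQ1 (by grind [EdgeOff, Edge, InBox]) n1 hG1 (by grind [InBox, Edge])
  · have hn : ¬ Patch D A B C E := fun h => hinc (Or.inl h)
    refine key C (Or.inl ⟨hC, c1, c3⟩) E (Or.inl ⟨hE, c4, c2⟩)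
      ⟨hCE.1, hCE.2.1, fun p q h => ⟨hCE.2.2 p q h, fun h' => ?_⟩⟩ n1 n2 hz1
    by_contra! h2
    exact hn ⟨fun h => c1 h.symm, fun h => c2 h.symm, p, q, h', h, by omega⟩

lemma incompEdges_finite (H : IsMaxSing S D) (A B : ℤ × ℤ) : (incompEdges S D A B).Finite :=
  (H.fin.prod H.fin).subset fun _ hT => ⟨hT.1, hT.2.1⟩

lemma exists_incomp (H : IsMaxSing S D) {A B : ℤ × ℤ} (hA : A ∈ S) (hB : B ∈ S)
    (hAB : Edge D A B) : ∃ C ∈ S, ∃ E ∈ S, Edge D C E ∧ Incomp D A B C E := by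
  obtain ⟨e, he, h⟩ := H.regular
  have h1 : (incompEdges S D A B).Nonempty := by
    rw [← Set.ncard_pos (H.incompEdges_finite A B), h A hA B hB hAB]
    exact he
  obtain ⟨T, h2, h3, h4, h5⟩ := h1
  exact ⟨T.1, h2, T.2, h3, h4, h5⟩

/-- Inclusion between the sets of incompatible edges of two edges is an equality. -/
lemma incomp_of_incomp (H : IsMaxSing S D) {A B C E : ℤ × ℤ} (hA : A ∈ S) (hB : B ∈ S)
    (hC : C ∈ S) (hE : E ∈ S) (hAB : Edge D A B) (hCE : Edge D C E)
    (hsub : ∀ U ∈ S, ∀ V ∈ S, Edge D U V → Incomp D A B U V → Incomp D C E U V)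
    {U V : ℤ × ℤ} (hU : U ∈ S) (hV : V ∈ S) (hUV : Edge D U V) (h : Incomp D C E U V) :
    Incomp D A B U V := by
  obtain ⟨e, he, hr⟩ := H.regular
  have heq : incompEdges S D A B = incompEdges S D C E := by
    refine Set.eq_of_subset_of_ncard_le ?_ ?_ (H.incompEdges_finite C E)
    · rintro T ⟨h2, h3, h4, h5⟩
      exact ⟨h2, h3, h4, hsub _ h2 _ h3 h4 h5⟩
    · rw [hr A hA B hB hAB, hr C hC E hE hCE]
  have : (U, V) ∈ incompEdges S D C E := ⟨hU, hV, hUV, h⟩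
  rw [← heq] at this
  exact this.2.2.2

/-- There are no two edges `(A, B)` and `(E, F)` with `B` south-west of `E`. -/
lemma no_separated_edges (H : IsMaxSing S D) {A B E F : ℤ × ℤ} (hA : A ∈ S) (hB : B ∈ S)
    (hE : E ∈ S) (hF : F ∈ S) (hAB : Edge D A B) (hEF : Edge D E F)
    (h1 : B.1 < E.1) (h2 : B.2 < E.2) : False := by
  have sub : ∀ U ∈ S, ∀ V ∈ S, Edge D U V → Incomp D A B U V → Incomp D E F U V := by
    intro U hU V hV hUV hs
    by_contra hn
    rcases hs with ⟨n1, n2, p, q, hz1, hz2, hz0⟩ | ⟨rfl, hl⟩ | ⟨rfl, hl⟩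
    · refine H.patch_persists hE hF hU hV hA hB hEF hUV hAB
        ⟨n1.symm, n2.symm, p, q, hz2, hz1, hz0⟩ ?_ ?_ ?_ ?_ ?_ hn ?_ ?_ <;>
      grind [Edge, InBox]
    · by_cases c1 : V = E
      · subst c1
        have hn' : ¬ Link D B V F := fun h => hn (Or.inr (Or.inr ⟨rfl, h⟩))
        obtain ⟨⟨p, q, hz, hz0⟩, p', q', hz', hz0'⟩ := hl
        by_cases c4 : ∃ p q, InBox (B.1, V.2) (V.1, F.2) p q ∧ D p q ≤ 0
        · have c5 : ∀ p q, InBox (V.1, B.2) (F.1, V.2) p q → ¬ D p q ≤ 0 :=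
            fun p q h h' => hn' ⟨c4, p, q, h, h'⟩
          refine H.no_link hE hF hEF (C := A) (E := B) (F := (F.1, V.2)) ?_ ?_ ?_ ?_ ?_
            ⟨⟨p, q, ?_, hz0⟩, p', q', ?_, hz0'⟩
          all_goals grind [swapPts, EdgeOff, Edge, InBox]
        · push Not at c4
          refine H.no_link hE hF hEF (C := A) (E := B) (F := (V.1, F.2)) ?_ ?_ ?_ ?_ ?_
            ⟨⟨p, q, ?_, hz0⟩, p', q', ?_, hz0'⟩
          all_goals grind [swapPts, EdgeOff, Edge, InBox]
      by_cases c2 : V = F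
      · subst c2
        exact H.link_cover_upper hA hB hV hE hAB hUV hl h1 h2 hEF.1 hEF.2.1
      · have hn' : ¬ Patch D E F B V := fun h => hn (Or.inl h)
        refine H.no_link hE hF hEF (C := A) (E := B) (F := V) ?_ ?_ ?_ ?_
          ⟨hUV.1, hUV.2.1, fun p q h => ⟨hUV.2.2 p q h, fun h' => ?_⟩⟩ hl
        · grind [swapPts, Edge]
        · grind [swapPts, Edge]
        · grind [swapPts, Edge]
        · grind [EdgeOff, Edge, InBox]
        · by_contra! h3
          exact hn' ⟨by grind, by grind, p, q, h', h, by omega⟩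
    · refine H.no_link hE hF hEF (C := U) (E := V) (F := B) ?_ ?_ ?_ ?_ ?_ hl
      all_goals grind [swapPts, EdgeOff, Edge, InBox]
  have only : ∀ U ∈ S, ∀ V ∈ S, Edge D U V → Incomp D A B U V → U = B ∧ V = E := by
    intro U hU V hV hUV hs
    have ht := sub U hU V hV hUV hs
    have hU1 : U = B ∨ (U.1 < B.1 ∧ U.2 < B.2) := by
      rcases hs with ⟨n1, n2, p, q, hz1, hz2, hz0⟩ | ⟨rfl, hl⟩ | ⟨rfl, hl⟩ <;>
        grind [InBox, Edge]
    have hV1 : V = E ∨ (E.1 < V.1 ∧ E.2 < V.2) := by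
      rcases ht with ⟨n1, n2, p, q, hz1, hz2, hz0⟩ | ⟨rfl, hl⟩ | ⟨rfl, hl⟩ <;>
        grind [InBox, Edge]
    rcases hU1 with c1 | c1 <;> rcases hV1 with c2 | c2
    · exact ⟨c1, c2⟩
    · exfalso
      subst c1
      have hl : Link D A U V := by
        rcases hs with ⟨n1, n2, p, q, hz1, hz2, hz0⟩ | ⟨_, hl⟩ | ⟨rfl, hl⟩
        · grind [InBox]
        · exact hl
        · grind [Edge]
      exact H.link_cover_upper hA hU hV hE hAB hUV hl h1 h2 c2.1 c2.2
    · exfalso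
      subst c2
      have hl : Link D U V F := by
        rcases ht with ⟨n1, n2, p, q, hz1, hz2, hz0⟩ | ⟨rfl, hl⟩ | ⟨_, hl⟩
        · grind [InBox]
        · grind [Edge]
        · exact hl
      exact H.link_cover_lower hU hV hF hB hUV hEF hl c1.1 c1.2 h1 h2
    · exfalso
      have hUB : Edge D U B := by grind [Edge, InBox]
      have hP : Patch D U V E F := by
        rcases ht with ⟨n1, n2, p, q, hz1, hz2, hz0⟩ | ⟨rfl, hl⟩ | ⟨rfl, hl⟩
        · exact ⟨n1.symm, n2.symm, p, q, hz2, hz1, hz0⟩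
        · grind [Edge]
        · grind [Edge]
      refine H.patch_persists hU hB hU hV hE hF hUB hUV hEF hP ?_ ?_ ?_ ?_ ?_ ?_ ?_ ?_ <;>
        grind [Edge, InBox, Incomp, Patch]
  obtain ⟨U, hU, V, hV, hUV, hs⟩ := H.exists_incomp hA hB hAB
  have ht := sub U hU V hV hUV hs
  obtain ⟨rfl, rfl⟩ := only U hU V hV hUV hs
  obtain ⟨e, he, hr⟩ := H.regular
  have e1 : e ≤ 1 := by
    rw [← hr A hA U hU hAB, Set.ncard_le_one (H.incompEdges_finite A U)]
    rintro ⟨a, b⟩ ⟨x1, x2, x3, x4⟩ ⟨c, d⟩ ⟨y1, y2, y3, y4⟩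
    have := only _ x1 _ x2 x3 x4
    have := only _ y1 _ y2 y3 y4
    grind
  rw [← hr U hU V hV hUV, Set.ncard_le_one (H.incompEdges_finite U V)] at e1
  have := e1 (A, U) ⟨hA, hU, hAB, hs.symm⟩ (V, F) ⟨hV, hF, hEF, ht.symm⟩
  grind [Edge]

/-- A zero of `D` in `[l, r) × [b, t)` can be chosen to have minimal first coordinate. -/
lemma exists_leftmost_zero {l r b t p q : ℤ} (h : InBox (l, b) (r, t) p q) (h0 : D p q ≤ 0) :
    ∃ p q, InBox (l, b) (r, t) p q ∧ D p q ≤ 0 ∧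
      ∀ p' q', InBox (l, b) (p, t) p' q' → 1 ≤ D p' q' := by
  obtain ⟨m, ⟨⟨q', hq, hq0⟩, hmin⟩⟩ := Int.exists_least_of_bdd
    (P := fun p => ∃ q, InBox (l, b) (r, t) p q ∧ D p q ≤ 0)
    ⟨l, fun z ⟨_, hz, _⟩ => hz.1⟩ ⟨p, q, h, h0⟩
  refine ⟨m, q', hq, hq0, fun p' q' hpq => ?_⟩
  by_contra hlt
  have := hmin p' ⟨q', by grind [InBox], by omega⟩
  grind [InBox]

/-- A zero of `D` in `[l, r) × [b, t)` can be chosen to have minimal second coordinate. -/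
lemma exists_lowest_zero {l r b t p q : ℤ} (h : InBox (l, b) (r, t) p q) (h0 : D p q ≤ 0) :
    ∃ p q, InBox (l, b) (r, t) p q ∧ D p q ≤ 0 ∧
      ∀ p' q', InBox (l, b) (r, q) p' q' → 1 ≤ D p' q' := by
  obtain ⟨m, ⟨⟨p', hp, hp0⟩, hmin⟩⟩ := Int.exists_least_of_bdd
    (P := fun q => ∃ p, InBox (l, b) (r, t) p q ∧ D p q ≤ 0)
    ⟨b, fun z ⟨_, hz, _⟩ => hz.2.2.1⟩ ⟨q, p, h, h0⟩
  refine ⟨p', m, hp, hp0, fun p' q' hpq => ?_⟩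
  by_contra hlt
  have := hmin q' ⟨p', by grind [InBox], by omega⟩
  grind [InBox]

lemma exists_mem_box (H : IsMaxSing S D) {p₁ p₂ q₁ q₂ : ℤ} (hp : p₁ ≤ p₂) (hq : q₁ ≤ q₂)
    (h : D p₂ q₁ - D p₁ q₁ - D p₂ q₂ + D p₁ q₂ ≤ -1) :
    ∃ P ∈ S, p₁ < P.1 ∧ P.1 ≤ p₂ ∧ q₁ < P.2 ∧ P.2 ≤ q₂ := by
  have h1 := H.box p₁ p₂ q₁ q₂ hp hq
  have h2 : 0 < {P ∈ S | p₁ < P.1 ∧ P.1 ≤ p₂ ∧ q₁ < P.2 ∧ P.2 ≤ q₂}.ncard := by omega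
  obtain ⟨P, hP⟩ := (Set.ncard_pos (H.fin.subset fun _ h => h.1)).1 h2
  exact ⟨P, hP⟩

lemma exists_mem_box_ne (H : IsMaxSing S D) {p₁ p₂ q₁ q₂ : ℤ} (hp : p₁ ≤ p₂) (hq : q₁ ≤ q₂)
    (h : D p₂ q₁ - D p₁ q₁ - D p₂ q₂ + D p₁ q₂ ≤ -2) (B : ℤ × ℤ) :
    ∃ P ∈ S, P ≠ B ∧ p₁ < P.1 ∧ P.1 ≤ p₂ ∧ q₁ < P.2 ∧ P.2 ≤ q₂ := by
  have h1 := H.box p₁ p₂ q₁ q₂ hp hq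
  have h2 : 1 < {P ∈ S | p₁ < P.1 ∧ P.1 ≤ p₂ ∧ q₁ < P.2 ∧ P.2 ≤ q₂}.ncard := by omega
  obtain ⟨P, hP, hne⟩ := Set.exists_ne_of_one_lt_ncard h2 B
  exact ⟨P, hP.1, hne, hP.2⟩

/-- An edge from `A` incompatible with `(U, V)` is incompatible with every edge `(P, Y)` starting
at a point `P` which is north-east of `A`, south-east of `B` and not the end of an edge. -/
lemma incomp_far_edge (H : IsMaxSing S D) {A B P Y : ℤ × ℤ} (hA : A ∈ S) (hB : B ∈ S)
    (hP : P ∈ S) (hY : Y ∈ S) (hAB : Edge D A B) (hPY : Edge D P Y) (h1 : A.1 < P.1)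
    (h2 : A.2 < P.2) (h3 : B.1 < P.1) (h4 : P.2 < B.2) (hno : ∀ U ∈ S, ¬ Edge D U P) :
    ∀ U ∈ S, ∀ V ∈ S, Edge D U V → Incomp D A B U V → Incomp D P Y U V := by
  have hzero : ∃ p q, InBox (B.1, A.2) (P.1, P.2) p q ∧ D p q ≤ 0 := by
    by_contra! hn
    exact hno A hA (by grind [Edge, InBox])
  intro U hU V hV hUV hs
  by_contra hn
  rcases hs with ⟨n1, n2, p, q, hz1, hz2, hz0⟩ | ⟨rfl, hl⟩ | ⟨rfl, hl⟩
  · refine H.patch_persists hP hY hU hV hA hB hPY hUV hAB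
        ⟨n1.symm, n2.symm, p, q, hz2, hz1, hz0⟩ ?_ ?_ ?_ ?_ ?_ hn ?_ ?_ <;>
      grind [Edge, InBox]
  · have hVP : V ≠ P := fun h => hno B hB (h ▸ hUV)
    by_cases c2 : V = Y
    · subst c2
      obtain ⟨⟨p, q, hz, hz0⟩, -⟩ := hl
      obtain ⟨p', q', hz', hz0'⟩ := hzero
      refine H.no_link hP hV hPY (C := A) (E := B) (F := (P.1, V.2)) ?_ ?_ ?_ ?_ ?_
        ⟨⟨p, q, ?_, hz0⟩, p', q', ?_, hz0'⟩
      all_goals grind [swapPts, EdgeOff, Edge, InBox]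
    · have hn' : ¬ Patch D P Y B V := fun h => hn (Or.inl h)
      refine H.no_link hP hY hPY (C := A) (E := B) (F := V) ?_ ?_ ?_ ?_
        ⟨hUV.1, hUV.2.1, fun p q h => ⟨hUV.2.2 p q h, fun h' => ?_⟩⟩ hl
      · grind [swapPts, Edge]
      · grind [swapPts, Edge]
      · grind [swapPts, Edge]
      · grind [EdgeOff, Edge, InBox]
      · by_contra! h3
        exact hn' ⟨by grind, by grind, p, q, h', h, by omega⟩
  · exact H.no_separated_edges hU hV hP hY hUV hPY h1 h2

set_option maxHeartbeats 1000000 in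
/-- If `A` is south-west of `P`, both start an edge, and that from `A` ends north-west of `P`,
then `P` also ends an edge. -/
lemma exists_edge_to (H : IsMaxSing S D) {A B P Y : ℤ × ℤ} (hA : A ∈ S) (hB : B ∈ S)
    (hP : P ∈ S) (hY : Y ∈ S) (hAB : Edge D A B) (hPY : Edge D P Y) (h1 : A.1 < P.1)
    (h2 : A.2 < P.2) (h3 : B.1 < P.1) (h4 : P.2 < B.2) : ∃ U ∈ S, Edge D U P := by
  by_contra! hno
  obtain ⟨B, ⟨hB, hAB, h3, h4⟩, hmin⟩ := Set.exists_min_image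
    {B ∈ S | Edge D A B ∧ B.1 < P.1 ∧ P.2 < B.2} (fun B => B.1) (H.fin.subset fun _ h => h.1)
    ⟨B, hB, hAB, h3, h4⟩
  have hsub := fun C hC hAC h5 h6 =>
    H.incomp_far_edge (B := C) hA hC hP hY hAC hPY h1 h2 h5 h6 hno
  have heq : ∀ C ∈ S, Edge D A C → C.1 < P.1 → P.2 < C.2 → ∀ U ∈ S, ∀ V ∈ S, Edge D U V →
      Incomp D A B U V → Incomp D A C U V := fun C hC hAC h5 h6 U hU V hV hUV hs =>
    H.incomp_of_incomp hA hC hP hY hAC hPY (hsub C hC hAC h5 h6) hU hV hUV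
      (hsub B hB hAB h3 h4 U hU V hV hUV hs)
  have hsep : ∀ C ∈ S, Edge D A C → C.1 < P.1 → P.2 < C.2 := by
    intro C hC hAC h5
    by_contra! h6
    have h7 : C.2 ≠ P.2 := fun h => by grind [H.inj_snd C hC P hP h]
    exact H.no_separated_edges hA hC hP hY hAC hPY h5 (by omega)
  have hzero : ∃ p q, InBox (B.1, A.2) (P.1, P.2) p q ∧ D p q ≤ 0 := by
    by_contra! hn
    exact hno A hA (by grind [Edge, InBox])
  obtain ⟨pz, qz, hz, hz0⟩ := hzero
  obtain ⟨U, hU, V, hV, hUV, hs⟩ := H.exists_incomp hA hB hAB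
  have ht := hsub B hB hAB h3 h4 U hU V hV hUV hs
  have hUB : U = B ∨ (U ≠ A ∧ V ≠ B ∧ ∃ p q, InBox A B p q ∧ InBox U V p q ∧ D p q ≤ 1) := by
    rcases hs with ⟨n1, n2, p, q, hz1, hz2, hz0⟩ | ⟨rfl, hl⟩ | ⟨rfl, hl⟩
    · exact Or.inr ⟨n1.symm, n2.symm, p, q, hz1, hz2, hz0⟩
    · exact Or.inl rfl
    · exact (H.no_separated_edges hU hV hP hY hUV hPY h1 h2).elim
  have hU1 : U.1 ≤ B.1 := by
    rcases hUB with rfl | ⟨_, _, p, q, hz1, hz2, hz0⟩ <;> grind [InBox]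
  have htP : Patch D P Y U V := by
    rcases ht with h | ⟨rfl, hl⟩ | ⟨rfl, hl⟩
    · exact h
    · grind [Edge]
    · exact (hno U hU hUV).elim
  obtain ⟨m1, m2, p', q', hw1, hw2, hw0⟩ := htP
  have hV1 : P.1 < V.1 ∧ P.2 < V.2 := by grind [InBox]
  have hU2 : P.2 < U.2 := by
    by_contra! h5
    have h7 : U.2 ≠ P.2 := fun h => by grind [H.inj_snd U hU P hP h]
    exact hno U hU (by grind [Edge, InBox])
  rcases hUB with rfl | ⟨n1, n2, p, q, hx1, hx2, hx0⟩
  · have hl : Link D A U V := by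
      rcases hs with ⟨n1, n2, p, q, hz1, hz2, hz0⟩ | ⟨_, hl⟩ | ⟨rfl, hl⟩
      · grind [InBox]
      · exact hl
      · grind [Edge]
    obtain ⟨⟨p₁, q₁, hy, hy0⟩, -⟩ := id hl
    obtain ⟨p₁, q₁, hy, hy0, hlow⟩ := exists_lowest_zero hy hy0
    obtain ⟨p₀, q₀, hz, hz0, hleft⟩ := exists_leftmost_zero (D := D) (l := U.1) (b := A.2)
      (r := P.1) (t := U.2) (p := pz) (q := qz) (by grind [InBox]) hz0
    have k1 := hAB.2.2 p₁ q₀ (by grind [InBox])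
    have k2 := hUV.2.2 p₀ q₁ (by grind [InBox])
    obtain ⟨C, hC, hCU, c1, c2, c3, c4⟩ := H.exists_mem_box_ne (p₁ := p₁) (p₂ := p₀) (q₁ := q₀)
      (q₂ := q₁) (by grind [InBox]) (by grind [InBox]) (by omega) U
    have e1 : C.1 ≠ U.1 := fun h => hCU (H.inj_fst C hC U hU h)
    have e2 : C.2 ≠ U.2 := fun h => hCU (H.inj_snd C hC U hU h)
    by_cases c5 : C.1 < U.1
    · have hAC : Edge D A C := by
        clear heq hsub hmin hsep hno
        grind [Edge, InBox]
      have h5 : C.1 < P.1 := c2.trans_lt hz.2.1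
      have := hmin C ⟨hC, hAC, h5, hsep C hC hAC h5⟩
      omega
    by_cases c6 : C.2 < U.2
    · have hAC : Edge D A C := by
        clear heq hsub hmin hsep hno
        grind [Edge, InBox]
      have h5 : C.1 < P.1 := c2.trans_lt hz.2.1
      have := heq C hC hAC h5 (hsep C hC hAC h5) U hU V hV hUV hs
      clear heq hsub hmin hsep hno hleft
      rcases this with ⟨_, _, r, s, g1, g2, _⟩ | ⟨rfl, _⟩ | ⟨rfl, _⟩
      · have := g1.2.2.2
        have := g2.2.2.1
        omega
      · omega
      · omega
    · exact H.link_cover_upper hA hU hV hC hAB hUV hl (by omega) (by omega)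
        (by grind [InBox]) (by grind [InBox])
  · have hUA : U.1 < A.1 := by
      by_contra! h5
      have h6 : U.1 ≠ A.1 := fun h => n1 (H.inj_fst U hU A hA h)
      have hUp : U.1 < B.1 := hx2.1.trans_lt hx1.2.1
      have hAU : Edge D A U := by
        clear heq hsub hmin hsep hno
        grind [Edge, InBox]
      have := hmin U ⟨hU, hAU, by omega, hU2⟩
      omega
    obtain ⟨p₀, q₀, hz, hz0, hleft⟩ := exists_leftmost_zero (D := D) (l := B.1) (b := A.2)
      (r := P.1) (t := U.2) (p := pz) (q := qz) (by grind [InBox]) hz0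
    have k1 := hAB.2.2 p q₀ (by grind [InBox])
    have k2 := hUV.2.2 p₀ q (by grind [InBox])
    obtain ⟨C, hC, c1, c2, c3, c4⟩ := H.exists_mem_box (p₁ := p) (p₂ := p₀) (q₁ := q₀)
      (q₂ := q) (by grind [InBox]) (by grind [InBox]) (by omega)
    have e1 : C.1 ≠ B.1 := fun h => by grind [H.inj_fst C hC B hB h, InBox]
    have e2 : C.2 ≠ U.2 := fun h => by grind [H.inj_snd C hC U hU h, InBox]
    by_cases c5 : C.1 < B.1
    · have hAC : Edge D A C := by
        clear heq hsub hmin hsep hno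
        grind [Edge, InBox]
      have h5 : C.1 < P.1 := c2.trans_lt hz.2.1
      have := hmin C ⟨hC, hAC, h5, hsep C hC hAC h5⟩
      omega
    by_cases c6 : C.2 < U.2
    · have hAC : Edge D A C := by
        clear heq hsub hmin hsep hno
        grind [Edge, InBox]
      have h5 : C.1 < P.1 := c2.trans_lt hz.2.1
      have := heq C hC hAC h5 (hsep C hC hAC h5) U hU V hV hUV hs
      clear heq hsub hmin hsep hno hleft
      rcases this with ⟨_, _, r, s, g1, g2, _⟩ | ⟨rfl, _⟩ | ⟨rfl, _⟩
      · have := g1.2.2.2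
        have := g2.2.2.1
        omega
      · omega
      · omega
    · clear heq hsub hmin hsep
      have hUC : Edge D U C := by grind [Edge, InBox]
      refine H.patch_persists hU hC hU hV hP hY hUC hUV hPY
        ⟨m1.symm, m2.symm, p', q', hw2, hw1, hw0⟩ ?_ ?_ ?_ ?_ ?_ ?_ ?_ ?_ <;>
      grind [Edge, InBox, Incomp, Patch]

end IsMaxSing

/-- Transposition of a function on the lattice. -/
def transposeFun (D : ℤ → ℤ → ℤ) (p q : ℤ) : ℤ := D q p

/-- Half-turn of a function on the lattice cells. -/
def rotateFun (D : ℤ → ℤ → ℤ) (p q : ℤ) : ℤ := D (-p - 1) (-q - 1)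

lemma inBox_swap {A B : ℤ × ℤ} {p q : ℤ} : InBox A.swap B.swap p q ↔ InBox A B q p := by
  grind [InBox, Prod.swap]

lemma edge_transpose {A B : ℤ × ℤ} : Edge (transposeFun D) A.swap B.swap ↔ Edge D A B := by
  simp only [Edge, inBox_swap, transposeFun, Prod.fst_swap, Prod.snd_swap]
  grind

lemma patch_transpose {A B C E : ℤ × ℤ} :
    Patch (transposeFun D) A.swap B.swap C.swap E.swap ↔ Patch D A B C E := by
  simp only [Patch, inBox_swap, transposeFun, ne_eq, Prod.swap_inj]
  grind

lemma link_transpose {A B C : ℤ × ℤ} :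
    Link (transposeFun D) C.swap A.swap B.swap ↔ Link D C A B := by
  simp only [Link, InBox, transposeFun, Prod.fst_swap, Prod.snd_swap]
  grind

lemma incomp_transpose {A B C E : ℤ × ℤ} :
    Incomp (transposeFun D) A.swap B.swap C.swap E.swap ↔ Incomp D A B C E := by
  simp only [Incomp, patch_transpose, link_transpose, Prod.swap_inj]

lemma lower_transpose {A B : ℤ × ℤ} :
    lower (transposeFun D) A.swap B.swap = transposeFun (lower D A B) := by
  funext p q
  simp only [lower, transposeFun, inBox_swap]

lemma mem_swapPts_transpose {A B P : ℤ × ℤ} :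
    P.swap ∈ swapPts (Prod.swap ⁻¹' S) A.swap B.swap ↔ P ∈ swapPts S A B := by
  obtain ⟨p1, p2⟩ := P
  obtain ⟨a1, a2⟩ := A
  obtain ⟨b1, b2⟩ := B
  simp only [swapPts, Set.mem_ofPred_eq, Set.mem_preimage, Prod.swap_prod_mk, ne_eq, Prod.mk.injEq]
  tauto

lemma forall_mem_swap {p : ℤ × ℤ → Prop} {S : Set (ℤ × ℤ)} :
    (∀ A ∈ S, p A) ↔ ∀ A : ℤ × ℤ, A.swap ∈ S → p A.swap :=
  ⟨fun h A hA => h _ hA, fun h A hA => by simpa using h A.swap (by simpa using hA)⟩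

theorem IsMaxSing.transpose (H : IsMaxSing S D) :
    IsMaxSing (Prod.swap ⁻¹' S) (transposeFun D) where
  fin := H.fin.preimage Prod.swap_injective.injOn
  inj_fst A hA B hB h := Prod.swap_injective (H.inj_snd _ hA _ hB h)
  inj_snd A hA B hB h := Prod.swap_injective (H.inj_fst _ hA _ hB h)
  nonneg p q := H.nonneg q p
  regular := by
    obtain ⟨e, he, h⟩ := H.regular
    refine ⟨e, he, ?_⟩
    rw [forall_mem_swap]
    intro A hA
    rw [forall_mem_swap]
    intro B hB hAB
    simp only [Set.mem_preimage, Prod.swap_swap] at hA hB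
    rw [← h A hA B hB (edge_transpose.1 hAB)]
    have : incompEdges (Prod.swap ⁻¹' S) (transposeFun D) A.swap B.swap =
        Prod.map Prod.swap Prod.swap '' incompEdges S D A B := by
      ext ⟨C, E⟩
      constructor
      · rintro ⟨h1, h2, h3, h4⟩
        refine ⟨(C.swap, E.swap), ⟨h1, h2, ?_, ?_⟩, by simp⟩
        · exact edge_transpose.1 (by simpa using h3)
        · exact incomp_transpose.1 (by simpa using h4)
      · rintro ⟨⟨C', E'⟩, ⟨h1, h2, h3, h4⟩, h⟩
        simp only [Prod.map_apply, Prod.mk.injEq] at h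
        obtain ⟨rfl, rfl⟩ := h
        exact ⟨by simpa using h1, by simpa using h2, edge_transpose.2 h3, incomp_transpose.2 h4⟩
    rw [this, Set.ncard_image_of_injective _
      (Prod.swap_injective.prodMap Prod.swap_injective)]
  compat := by
    rw [forall_mem_swap]
    intro A hA
    rw [forall_mem_swap]
    intro B hB hAB
    simp only [Set.mem_preimage, Prod.swap_swap] at hA hB
    rw [forall_mem_swap]
    intro C hC
    rw [forall_mem_swap]
    intro E hE
    rw [forall_mem_swap]
    intro F hF
    rw [forall_mem_swap]
    intro G hG
    rw [mem_swapPts_transpose] at hC hE hF hG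
    rw [lower_transpose, edge_transpose, edge_transpose, incomp_transpose]
    exact H.compat A hA B hB (edge_transpose.1 hAB) C hC E hE F hF G hG
  box p₁ p₂ q₁ q₂ hp hq := by
    have h := H.box q₁ q₂ p₁ p₂ hq hp
    have : {P ∈ Prod.swap ⁻¹' S | p₁ < P.1 ∧ P.1 ≤ p₂ ∧ q₁ < P.2 ∧ P.2 ≤ q₂} =
        Prod.swap '' {P ∈ S | q₁ < P.1 ∧ P.1 ≤ q₂ ∧ p₁ < P.2 ∧ P.2 ≤ p₂} := by
      rw [Set.image_swap_eq_preimage_swap]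
      ext P
      simp only [Set.mem_preimage, Set.mem_ofPred_eq, Prod.fst_swap, Prod.snd_swap]
      tauto
    rw [this, Set.ncard_image_of_injective _ Prod.swap_injective]
    simp only [transposeFun]
    linarith

lemma edge_rotate {A B : ℤ × ℤ} : Edge (rotateFun D) (-B) (-A) ↔ Edge D A B := by
  simp only [Edge, InBox, rotateFun, Prod.fst_neg, Prod.snd_neg]
  refine ⟨fun ⟨h1, h2, h⟩ => ⟨by omega, by omega, fun p q hpq => ?_⟩,
    fun ⟨h1, h2, h⟩ => ⟨by omega, by omega, fun p q hpq => h _ _ (by omega)⟩⟩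
  have := h (-p - 1) (-q - 1) (by omega)
  simpa using this

lemma exists_neg_cell {f : ℤ → ℤ → Prop} : (∃ p q, f (-p - 1) (-q - 1)) ↔ ∃ p q, f p q :=
  ⟨fun ⟨p, q, h⟩ => ⟨_, _, h⟩, fun ⟨p, q, h⟩ => ⟨-p - 1, -q - 1, by simpa using h⟩⟩

lemma inBox_rotate {A B : ℤ × ℤ} {p q : ℤ} : InBox (-B) (-A) p q ↔ InBox A B (-p - 1) (-q - 1) := by
  simp only [InBox, Prod.fst_neg, Prod.snd_neg]
  omega

lemma patch_rotate {A B C E : ℤ × ℤ} :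
    Patch (rotateFun D) (-B) (-A) (-E) (-C) ↔ Patch D A B C E := by
  simp only [Patch, inBox_rotate, rotateFun, ne_eq, neg_inj]
  rw [exists_neg_cell (f := fun p q => InBox A B p q ∧ InBox C E p q ∧ D p q ≤ 1)]
  tauto

lemma link_rotate {A B C : ℤ × ℤ} :
    Link (rotateFun D) (-B) (-A) (-C) ↔ Link D C A B := by
  have h1 : ∀ p q, InBox ((-B).1, (-A).2) ((-A).1, (-C).2) p q ↔
      InBox (A.1, C.2) (B.1, A.2) (-p - 1) (-q - 1) :=
    fun p q => inBox_rotate (A := (A.1, C.2)) (B := (B.1, A.2))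
  have h2 : ∀ p q, InBox ((-A).1, (-B).2) ((-C).1, (-A).2) p q ↔
      InBox (C.1, A.2) (A.1, B.2) (-p - 1) (-q - 1) :=
    fun p q => inBox_rotate (A := (C.1, A.2)) (B := (A.1, B.2))
  simp only [Link, h1, h2, rotateFun]
  rw [exists_neg_cell (f := fun p q => InBox (A.1, C.2) (B.1, A.2) p q ∧ D p q ≤ 0),
    exists_neg_cell (f := fun p q => InBox (C.1, A.2) (A.1, B.2) p q ∧ D p q ≤ 0)]
  tauto

lemma incomp_rotate {A B C E : ℤ × ℤ} :
    Incomp (rotateFun D) (-B) (-A) (-E) (-C) ↔ Incomp D A B C E := by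
  simp only [Incomp, patch_rotate, link_rotate, neg_inj]
  grind

lemma lower_rotate {A B : ℤ × ℤ} :
    lower (rotateFun D) (-B) (-A) = rotateFun (lower D A B) := by
  funext p q
  simp only [lower, rotateFun, inBox_rotate]

lemma mem_swapPts_rotate {A B P : ℤ × ℤ} :
    -P ∈ swapPts (-S) (-B) (-A) ↔ P ∈ swapPts S A B := by
  obtain ⟨p1, p2⟩ := P
  obtain ⟨a1, a2⟩ := A
  obtain ⟨b1, b2⟩ := B
  simp only [swapPts, Set.mem_ofPred_eq, Set.mem_neg, neg_neg, ne_eq, neg_inj,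
    Prod.neg_mk, Prod.mk.injEq]
  tauto

lemma forall_mem_neg {p : ℤ × ℤ → Prop} {S : Set (ℤ × ℤ)} :
    (∀ A ∈ S, p A) ↔ ∀ A, -A ∈ S → p (-A) :=
  ⟨fun h A hA => h _ hA, fun h A hA => by simpa using h (-A) (by simpa using hA)⟩

theorem IsMaxSing.rotate (H : IsMaxSing S D) : IsMaxSing (-S) (rotateFun D) where
  fin := H.fin.neg
  inj_fst A hA B hB h := neg_injective (H.inj_fst _ hA _ hB (by simpa using h))
  inj_snd A hA B hB h := neg_injective (H.inj_snd _ hA _ hB (by simpa using h))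
  nonneg p q := H.nonneg _ _
  regular := by
    obtain ⟨e, he, h⟩ := H.regular
    refine ⟨e, he, ?_⟩
    rw [forall_mem_neg]
    intro B hB
    rw [forall_mem_neg]
    intro A hA hAB
    simp only [Set.mem_neg, neg_neg] at hA hB
    rw [← h A hA B hB (edge_rotate.1 hAB)]
    have : incompEdges (-S) (rotateFun D) (-B) (-A) =
        (fun T : (ℤ × ℤ) × (ℤ × ℤ) => (-T.2, -T.1)) '' incompEdges S D A B := by
      ext ⟨C, E⟩
      constructor
      · rintro ⟨h1, h2, h3, h4⟩
        refine ⟨(-E, -C), ⟨h2, h1, ?_, ?_⟩, by simp⟩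
        · exact edge_rotate.1 (by simpa using h3)
        · exact incomp_rotate.1 (by simpa using h4)
      · rintro ⟨⟨C', E'⟩, ⟨h1, h2, h3, h4⟩, h⟩
        simp only [Prod.mk.injEq] at h
        obtain ⟨rfl, rfl⟩ := h
        exact ⟨by simpa using h2, by simpa using h1, edge_rotate.2 h3, incomp_rotate.2 h4⟩
    rw [this, Set.ncard_image_of_injective]
    rintro ⟨a, b⟩ ⟨c, d⟩ h
    simp only [Prod.mk.injEq, neg_inj] at h
    rw [h.1, h.2]
  compat := by
    rw [forall_mem_neg]
    intro B hB
    rw [forall_mem_neg]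
    intro A hA hAB
    simp only [Set.mem_neg, neg_neg] at hA hB
    rw [forall_mem_neg]
    intro E hE
    rw [forall_mem_neg]
    intro C hC
    rw [forall_mem_neg]
    intro G hG
    rw [forall_mem_neg]
    intro F hF
    rw [mem_swapPts_rotate] at hC hE hF hG
    rw [lower_rotate, edge_rotate, edge_rotate, incomp_rotate]
    exact H.compat A hA B hB (edge_rotate.1 hAB) C hC E hE F hF G hG
  box p₁ p₂ q₁ q₂ hp hq := by
    have h := H.box (-p₂ - 1) (-p₁ - 1) (-q₂ - 1) (-q₁ - 1) (by omega) (by omega)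
    have : {P ∈ -S | p₁ < P.1 ∧ P.1 ≤ p₂ ∧ q₁ < P.2 ∧ P.2 ≤ q₂} =
        -{P ∈ S | -p₂ - 1 < P.1 ∧ P.1 ≤ -p₁ - 1 ∧ -q₂ - 1 < P.2 ∧ P.2 ≤ -q₁ - 1} := by
      ext P
      simp only [Set.mem_neg, Set.mem_ofPred_eq, Prod.fst_neg, Prod.snd_neg]
      refine and_congr_right fun _ => ?_
      omega
    rw [this, Set.ncard_neg]
    simp only [rotateFun]
    linarith

/-- If `P` starts an edge and lies north-east of an endpoint of an edge, then `P` ends an edge. -/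
lemma IsMaxSing.exists_edge_to_of_lt (H : IsMaxSing S D) {A P Y : ℤ × ℤ} (hA : A ∈ S)
    (hP : P ∈ S) (hY : Y ∈ S) (hAe : ∃ B ∈ S, Edge D A B ∨ Edge D B A) (hPY : Edge D P Y)
    (h1 : A.1 < P.1) (h2 : A.2 < P.2) : ∃ U ∈ S, Edge D U P := by
  obtain ⟨B, hB, hAB | hBA⟩ := hAe
  swap
  · exact (H.no_separated_edges hB hA hP hY hBA hPY h1 h2).elim
  rcases lt_trichotomy B.1 P.1 with h3 | h3 | h3
  · rcases lt_trichotomy B.2 P.2 with h4 | h4 | h4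
    · exact (H.no_separated_edges hA hB hP hY hAB hPY h3 h4).elim
    · exact ⟨A, hA, H.inj_snd B hB P hP h4 ▸ hAB⟩
    · exact H.exists_edge_to hA hB hP hY hAB hPY h1 h2 h3 h4
  · exact ⟨A, hA, H.inj_fst B hB P hP h3 ▸ hAB⟩
  · rcases lt_trichotomy B.2 P.2 with h4 | h4 | h4
    · obtain ⟨U, hU, hUP⟩ := H.transpose.exists_edge_to (A := A.swap) (B := B.swap)
        (P := P.swap) (Y := Y.swap) (by simpa using hA) (by simpa using hB) (by simpa using hP)
        (by simpa using hY) (edge_transpose.2 hAB) (edge_transpose.2 hPY) h2 h1 h4 h3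
      exact ⟨U.swap, hU, edge_transpose.1 (by simpa using hUP)⟩
    · exact ⟨A, hA, H.inj_snd B hB P hP h4 ▸ hAB⟩
    · exact ⟨A, hA, h1, h2, fun p q h => hAB.2.2 p q (by grind [InBox])⟩

/-- No four endpoints of edges form an increasing chain. -/
theorem IsMaxSing.no_chain (H : IsMaxSing S D) {A B C E : ℤ × ℤ} (hA : A ∈ S) (hB : B ∈ S)
    (hC : C ∈ S) (hE : E ∈ S) (hAe : ∃ P ∈ S, Edge D A P ∨ Edge D P A)
    (hBe : ∃ P ∈ S, Edge D B P ∨ Edge D P B) (hCe : ∃ P ∈ S, Edge D C P ∨ Edge D P C)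
    (hEe : ∃ P ∈ S, Edge D E P ∨ Edge D P E) (h1 : A.1 < B.1) (h2 : A.2 < B.2)
    (h3 : B.1 < C.1) (h4 : B.2 < C.2) (h5 : C.1 < E.1) (h6 : C.2 < E.2) : False := by
  have hB' : ∃ U ∈ S, Edge D U B := by
    obtain ⟨P, hP, h | h⟩ := hBe
    · exact H.exists_edge_to_of_lt hA hB hP hAe h h1 h2
    · exact ⟨P, hP, h⟩
  have hC' : ∃ U ∈ S, Edge D C U := by
    obtain ⟨P, hP, h | h⟩ := hCe
    · exact ⟨P, hP, h⟩
    · obtain ⟨Q, hQ, hQ'⟩ := hEe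
      obtain ⟨U, hU, hUC⟩ := H.rotate.exists_edge_to_of_lt (A := -E) (P := -C) (Y := -P)
        (by simpa using hE) (by simpa using hC) (by simpa using hP)
        ⟨-Q, by simpa using hQ, by rw [edge_rotate, edge_rotate]; exact hQ'.symm⟩
        (edge_rotate.2 h) (by simpa using h5) (by simpa using h6)
      exact ⟨-U, hU, edge_rotate.1 (by simpa using hUC)⟩
  obtain ⟨U, hU, hUB⟩ := hB'
  obtain ⟨V, hV, hCV⟩ := hC'
  exact H.no_separated_edges hU hB hC hV hUB hCV h3 h4

end Plane

/-- The indicator of a proposition, as an integer. -/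
noncomputable def ind (p : Prop) : ℤ := if p then 1 else 0

lemma ind_true {p : Prop} (h : p) : ind p = 1 := if_pos h

lemma ind_false {p : Prop} (h : ¬ p) : ind p = 0 := if_neg h

lemma ind_congr {p q : Prop} (h : p ↔ q) : ind p = ind q := by rw [h]

lemma card_filter_eq_sum_ind {α : Type*} [Fintype α] (p : α → Prop) [DecidablePred p] :
    (((Finset.univ.filter p).card : ℕ) : ℤ) = ∑ i, ind (p i) := by
  rw [Finset.card_filter]
  push_cast
  exact Finset.sum_congr rfl fun i _ => by unfold ind; congr

section Geometry

variable {D : ℤ → ℤ → ℤ}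

lemma edge_lower_of_disjoint {A B C E : ℤ × ℤ}
    (h : ∀ p q, InBox C E p q → ¬ InBox A B p q) : Edge (lower D A B) C E ↔ Edge D C E := by
  refine and_congr_right fun _ => and_congr_right fun _ => ?_
  refine forall₃_congr fun p q hpq => ?_
  rw [lower, if_neg (h p q hpq), sub_zero]

/-- `P` is north-west of `Q`. -/
def Inv (P Q : ℤ × ℤ) : Prop := P.1 < Q.1 ∧ Q.2 < P.2

lemma ind_corner {x u v xu xv y l : Prop} (h₁ : xu ↔ x ∧ u) (h₂ : xv ↔ x ∧ v)
    (h₃ : y ↔ x ∧ u ∧ v) (h₄ : l ↔ ¬ u ∧ ¬ v) :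
    ind y = ind xu + ind xv + ind (x ∧ l) - ind x := by
  rw [ind_congr h₁, ind_congr h₂, ind_congr h₃, h₄]
  by_cases x <;> by_cases u <;> by_cases v <;> simp [ind, *]

lemma edge_swap_third {A B C : ℤ × ℤ} (hAB : Edge D A B) (h1 : C.1 ≠ A.1) (h2 : C.1 ≠ B.1)
    (h3 : C.2 ≠ A.2) (h4 : C.2 ≠ B.2) :
    ind (Edge D A C) + ind (Edge D C A) + ind (Edge D B C) + ind (Edge D C B) =
      ind (Edge D (A.1, B.2) C) + ind (Edge D C (A.1, B.2)) + ind (Edge D (B.1, A.2) C) +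
      ind (Edge D C (B.1, A.2)) +
      (ind (Inv (A.1, B.2) C) - ind (Inv A C) + (ind (Inv C (A.1, B.2)) - ind (Inv C A)) +
        (ind (Inv (B.1, A.2) C) - ind (Inv B C)) + (ind (Inv C (B.1, A.2)) - ind (Inv C B))) +
      (ind (Edge D B C ∧ Link D A B C) + ind (Edge D C A ∧ Link D C A B)) := by
  obtain ⟨a1, a2⟩ := A
  obtain ⟨b1, b2⟩ := B
  obtain ⟨c1, c2⟩ := C
  obtain ⟨hab1, hab2, hab⟩ := hAB
  dsimp only at *
  rcases lt_or_gt_of_ne h1 with k1 | k1 <;> rcases lt_or_gt_of_ne h2 with k2 | k2 <;>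
    rcases lt_or_gt_of_ne h3 with k3 | k3 <;> rcases lt_or_gt_of_ne h4 with k4 | k4 <;>
    first | (exfalso; omega) | skip
  all_goals simp only [Edge, Inv, k1, k2, k3, k4, k1.not_gt, k2.not_gt, k3.not_gt, k4.not_gt, true_and,
    false_and, and_false, and_true, ind_true, ind_false, not_false_eq_true]
  · rw [ind_corner (x := ∀ p q, InBox (c1, c2) (a1, a2) p q → 1 ≤ D p q)
      (u := ∀ p q, InBox (c1, a2) (a1, b2) p q → 1 ≤ D p q)
      (v := ∀ p q, InBox (a1, c2) (b1, a2) p q → 1 ≤ D p q)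
      (xu := ∀ p q, InBox (c1, c2) (a1, b2) p q → 1 ≤ D p q)
      (xv := ∀ p q, InBox (c1, c2) (b1, a2) p q → 1 ≤ D p q)
      (y := ∀ p q, InBox (c1, c2) (b1, b2) p q → 1 ≤ D p q) (l := Link D (c1, c2) (a1, a2) (b1, b2))]
    · ring
    · grind [InBox]
    · grind [InBox]
    · grind [InBox]
    · grind [Link]
  · rw [ind_congr (q := ∀ p q, InBox (c1, c2) (a1, b2) p q → 1 ≤ D p q) (by grind [InBox])]
    ring
  · norm_num
  · rw [ind_congr (q := ∀ p q, InBox (c1, c2) (b1, a2) p q → 1 ≤ D p q) (by grind [InBox])]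
    ring
  · rw [ind_true (by grind [InBox]), ind_true (by grind [InBox])]
    norm_num
  · rw [ind_congr (q := ∀ p q, InBox (a1, b2) (c1, c2) p q → 1 ≤ D p q) (by grind [InBox])]
    ring
  · norm_num
  · rw [ind_congr (q := ∀ p q, InBox (b1, a2) (c1, c2) p q → 1 ≤ D p q) (by grind [InBox])]
    ring
  · rw [ind_corner (x := ∀ p q, InBox (b1, b2) (c1, c2) p q → 1 ≤ D p q)
      (u := ∀ p q, InBox (a1, b2) (b1, c2) p q → 1 ≤ D p q)
      (v := ∀ p q, InBox (b1, a2) (c1, b2) p q → 1 ≤ D p q)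
      (xu := ∀ p q, InBox (a1, b2) (c1, c2) p q → 1 ≤ D p q)
      (xv := ∀ p q, InBox (b1, a2) (c1, c2) p q → 1 ≤ D p q)
      (y := ∀ p q, InBox (a1, a2) (c1, c2) p q → 1 ≤ D p q) (l := Link D (a1, a2) (b1, b2) (c1, c2))]
    · ring
    · grind [InBox]
    · grind [InBox]
    · grind [InBox]
    · grind [Link]

lemma inv_swap_third {A B C : ℤ × ℤ} (hab1 : A.1 < B.1) (hab2 : A.2 < B.2) (h1 : C.1 ≠ A.1)
    (h2 : C.1 ≠ B.1) (h3 : C.2 ≠ A.2) (h4 : C.2 ≠ B.2) :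
    0 ≤ ind (Inv (A.1, B.2) C) - ind (Inv A C) + (ind (Inv C (A.1, B.2)) - ind (Inv C A)) +
        (ind (Inv (B.1, A.2) C) - ind (Inv B C)) + (ind (Inv C (B.1, A.2)) - ind (Inv C B)) := by
  rcases lt_or_gt_of_ne h1 with k1 | k1 <;> rcases lt_or_gt_of_ne h2 with k2 | k2 <;>
    rcases lt_or_gt_of_ne h3 with k3 | k3 <;> rcases lt_or_gt_of_ne h4 with k4 | k4 <;>
    first | (exfalso; omega) | skip
  all_goals simp [Inv, k1, k2, k3, k4, k1.not_gt, k2.not_gt, k3.not_gt, k4.not_gt,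
    ind_true, ind_false]

lemma incomp_third {A B C : ℤ × ℤ} (hAB : Edge D A B) :
    ind (Edge D A C ∧ Incomp D A B A C) + ind (Edge D C A ∧ Incomp D A B C A) +
        ind (Edge D B C ∧ Incomp D A B B C) + ind (Edge D C B ∧ Incomp D A B C B) =
      ind (Edge D B C ∧ Link D A B C) + ind (Edge D C A ∧ Link D C A B) := by
  have e1 : ¬ (Edge D A C ∧ Incomp D A B A C) := by grind [Incomp, Patch, Edge]
  have e2 : ¬ (Edge D C B ∧ Incomp D A B C B) := by grind [Incomp, Patch, Edge]
  have e3 : Edge D B C ∧ Incomp D A B B C ↔ Edge D B C ∧ Link D A B C := by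
    grind [Incomp, Patch, Edge, InBox]
  have e4 : Edge D C A ∧ Incomp D A B C A ↔ Edge D C A ∧ Link D C A B := by
    grind [Incomp, Patch, Edge, InBox]
  rw [ind_false e1, ind_false e2, ind_congr e3, ind_congr e4]
  ring

lemma edge_lower_third {A B C : ℤ × ℤ} :
    (Edge (lower D A B) (A.1, B.2) C ↔ Edge D (A.1, B.2) C) ∧
    (Edge (lower D A B) C (A.1, B.2) ↔ Edge D C (A.1, B.2)) ∧
    (Edge (lower D A B) (B.1, A.2) C ↔ Edge D (B.1, A.2) C) ∧
    (Edge (lower D A B) C (B.1, A.2) ↔ Edge D C (B.1, A.2)) := by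
  refine ⟨?_, ?_, ?_, ?_⟩ <;> refine edge_lower_of_disjoint fun p q h h' => ?_ <;>
    simp only [InBox] at h h' <;> omega

lemma edge_lower_other {A B C E : ℤ × ℤ} (h1 : C ≠ A) (h2 : C ≠ B) (h3 : E ≠ A) (h4 : E ≠ B) :
    ind (Edge D C E) = ind (Edge (lower D A B) C E) + ind (Edge D C E ∧ Incomp D A B C E) := by
  by_cases hl : Edge (lower D A B) C E
  · have h5 : Edge D C E := ⟨hl.1, hl.2.1, fun p q h => (hl.2.2 p q h).trans (lower_le D A B p q)⟩
    have h6 : ¬ (Edge D C E ∧ Incomp D A B C E) := by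
      rintro ⟨-, ⟨-, -, p, q, g1, g2, g3⟩ | ⟨rfl, -⟩ | ⟨rfl, -⟩⟩
      · have := hl.2.2 p q g2
        rw [lower, if_pos g1] at this
        omega
      · exact h2 rfl
      · exact h3 rfl
    rw [ind_true h5, ind_true hl, ind_false h6, add_zero]
  · rw [ind_false hl, zero_add]
    refine ind_congr (and_iff_left_of_imp fun h => ?_).symm
    have h5 : ¬ ∀ p q, InBox C E p q → 1 ≤ lower D A B p q := fun h' => hl ⟨h.1, h.2.1, h'⟩
    push Not at h5
    obtain ⟨p, q, g1, g2⟩ := h5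
    have g3 := h.2.2 p q g1
    unfold lower at g2
    split at g2
    · exact Or.inl ⟨h1.symm, h4.symm, p, q, ‹_›, g1, by omega⟩
    · omega

end Geometry

section Sums

variable {n : ℕ}

lemma sum_eq_add_add_sum (F : Fin n → ℤ) {a b : Fin n} (hab : a ≠ b) :
    ∑ i, F i = F a + F b + ∑ i ∈ ({a, b} : Finset (Fin n))ᶜ, F i := by
  rw [← Finset.sum_add_sum_compl {a, b}, Finset.sum_pair hab]

lemma sum_sum_eq_of_eq_zero (F : Fin n → Fin n → ℤ) {a b : Fin n} (hab : a ≠ b)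
    (h : ∀ i j, i ≠ a → i ≠ b → j ≠ a → j ≠ b → F i j = 0) :
    ∑ i, ∑ j, F i j = F a a + F a b + F b a + F b b +
      ∑ c ∈ ({a, b} : Finset (Fin n))ᶜ, (F a c + F c a + F b c + F c b) := by
  have h1 : ∀ i ∈ ({a, b} : Finset (Fin n))ᶜ, ∑ j, F i j = F i a + F i b := by
    intro i hi
    simp only [Finset.mem_compl, Finset.mem_insert, Finset.mem_singleton, not_or] at hi
    rw [sum_eq_add_add_sum _ hab, Finset.sum_eq_zero, add_zero]
    intro j hj
    simp only [Finset.mem_compl, Finset.mem_insert, Finset.mem_singleton, not_or] at hj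
    exact h i j hi.1 hi.2 hj.1 hj.2
  rw [sum_eq_add_add_sum _ hab, Finset.sum_congr rfl h1, sum_eq_add_add_sum (F a) hab,
    sum_eq_add_add_sum (F b) hab]
  simp only [Finset.sum_add_distrib]
  ring

end Sums

section Perm

variable {n : ℕ}

/-- The point of the graph of `x` over `i`. -/
def pt (x : Equiv.Perm (Fin n)) (i : Fin n) : ℤ × ℤ := (((i : ℕ) : ℤ), ((x i : ℕ) : ℤ))

/-- The function `d_{x,w}` as a function on lattice cells. -/
def ht (x w : Equiv.Perm (Fin n)) (p q : ℤ) : ℤ := dxw x w (p + 1) (q + 2)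

lemma ht_eq_sum (x w : Equiv.Perm (Fin n)) (p q : ℤ) :
    ht x w p q = ∑ k, (ind ((pt w k).1 ≤ p ∧ q < (pt w k).2) -
      ind ((pt x k).1 ≤ p ∧ q < (pt x k).2)) := by
  rw [Finset.sum_sub_distrib, ht, dxw, rank, rank, card_filter_eq_sum_ind, card_filter_eq_sum_ind]
  congr 1 <;> refine Finset.sum_congr rfl fun k _ => ind_congr ?_ <;> simp only [pt] <;> omega

lemma bruhatLE_iff {x w : Equiv.Perm (Fin n)} : bruhatLE x w ↔ ∀ p q, 0 ≤ ht x w p q :=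
  ⟨fun h p q => h _ _, fun h p q => by simpa [ht] using h (p - 1) (q - 2)⟩

lemma invLen_eq_sum (x : Equiv.Perm (Fin n)) :
    (invLen x : ℤ) = ∑ i, ∑ j, ind (Inv (pt x i) (pt x j)) := by
  rw [invLen, card_filter_eq_sum_ind, Fintype.sum_prod_type]
  refine Finset.sum_congr rfl fun i _ => Finset.sum_congr rfl fun j _ => ind_congr ?_
  simp [Inv, pt]

lemma pt_mul_swap_left (x : Equiv.Perm (Fin n)) (a b : Fin n) :
    pt (x * Equiv.swap a b) a = ((pt x a).1, (pt x b).2) := by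
  simp [pt]

lemma pt_mul_swap_right (x : Equiv.Perm (Fin n)) (a b : Fin n) :
    pt (x * Equiv.swap a b) b = ((pt x b).1, (pt x a).2) := by
  simp [pt]

lemma pt_mul_swap_of_ne (x : Equiv.Perm (Fin n)) {a b c : Fin n} (h1 : c ≠ a) (h2 : c ≠ b) :
    pt (x * Equiv.swap a b) c = pt x c := by
  simp [pt, Equiv.swap_apply_of_ne_of_ne h1 h2]

lemma pt_fst_inj {x : Equiv.Perm (Fin n)} {i j : Fin n} : (pt x i).1 = (pt x j).1 ↔ i = j := by
  simp [pt, Fin.ext_iff]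

lemma pt_snd_inj {x : Equiv.Perm (Fin n)} {i j : Fin n} : (pt x i).2 = (pt x j).2 ↔ i = j := by
  simp [pt, Fin.val_inj]

lemma pt_injective (x : Equiv.Perm (Fin n)) : Function.Injective (pt x) :=
  fun _ _ h => pt_fst_inj.1 (congrArg Prod.fst h)

lemma ht_mul_swap (x w : Equiv.Perm (Fin n)) {a b : Fin n} (h1 : (pt x a).1 < (pt x b).1)
    (h2 : (pt x a).2 < (pt x b).2) :
    ht (x * Equiv.swap a b) w = lower (ht x w) (pt x a) (pt x b) := by
  have hab : a ≠ b := by rintro rfl; exact h1.false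
  funext p q
  rw [lower, ht_eq_sum, ht_eq_sum, Finset.sum_sub_distrib, Finset.sum_sub_distrib, sub_sub]
  congr 1
  rw [sum_eq_add_add_sum _ hab, sum_eq_add_add_sum _ hab, pt_mul_swap_left, pt_mul_swap_right]
  have : ∀ c ∈ ({a, b} : Finset (Fin n))ᶜ, pt (x * Equiv.swap a b) c = pt x c := by
    intro c hc
    simp only [Finset.mem_compl, Finset.mem_insert, Finset.mem_singleton, not_or] at hc
    exact pt_mul_swap_of_ne x hc.1 hc.2
  rw [Finset.sum_congr rfl fun c hc => by rw [this c hc]]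
  simp only [ind, InBox]
  split_ifs <;> omega

end Perm

section Bruhat

variable {n : ℕ} {x w : Equiv.Perm (Fin n)} {a b : Fin n}

lemma invLen_lt_mul_swap (h1 : (pt x a).1 < (pt x b).1) (h2 : (pt x a).2 < (pt x b).2) :
    invLen x < invLen (x * Equiv.swap a b) := by
  have hab : a ≠ b := by rintro rfl; exact h1.false
  have key : (0 : ℤ) < ∑ i, ∑ j, (ind (Inv (pt (x * Equiv.swap a b) i) (pt (x * Equiv.swap a b) j)) -
      ind (Inv (pt x i) (pt x j))) := by
    rw [sum_sum_eq_of_eq_zero _ hab]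
    · rw [pt_mul_swap_left, pt_mul_swap_right]
      refine add_pos_of_pos_of_nonneg ?_ (Finset.sum_nonneg fun c hc => ?_)
      · simp only [ind, Inv]
        split_ifs <;> omega
      · simp only [Finset.mem_compl, Finset.mem_insert, Finset.mem_singleton, not_or] at hc
        rw [pt_mul_swap_of_ne x hc.1 hc.2]
        exact inv_swap_third h1 h2 (mt pt_fst_inj.1 hc.1) (mt pt_fst_inj.1 hc.2)
          (mt pt_snd_inj.1 hc.1) (mt pt_snd_inj.1 hc.2)
    · intro i j h1 h2 h3 h4
      rw [pt_mul_swap_of_ne x h1 h2, pt_mul_swap_of_ne x h3 h4, sub_self]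
  simp only [Finset.sum_sub_distrib] at key
  rw [← invLen_eq_sum, ← invLen_eq_sum] at key
  omega

lemma swap_mem_R (hx : bruhatLE x w) (hab : a < b) :
    Equiv.swap a b ∈ R x w ↔ Edge (ht x w) (pt x a) (pt x b) := by
  have h1 : (pt x a).1 < (pt x b).1 := by simpa [pt] using hab
  by_cases h2 : (pt x a).2 < (pt x b).2
  · have h3 : Equiv.swap a b ∈ R x w ↔ bruhatLE (x * Equiv.swap a b) w :=
      ⟨fun h => h.2.2, fun h => ⟨⟨a, b, hab.ne, rfl⟩, invLen_lt_mul_swap h1 h2, h⟩⟩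
    rw [h3, bruhatLE_iff, ht_mul_swap x w h1 h2]
    constructor
    · refine fun h => ⟨h1, h2, fun p q hpq => ?_⟩
      have := h p q
      rw [lower, if_pos hpq] at this
      omega
    · intro h p q
      have h4 := bruhatLE_iff.1 hx p q
      have h5 := h.2.2 p q
      unfold lower
      split
      · have := h5 ‹_›
        omega
      · omega
  · refine iff_of_false (fun h => ?_) fun h => h2 h.2.1
    have h3 : (pt x b).2 < (pt x a).2 :=
      lt_of_le_of_ne (not_lt.1 h2) fun h => hab.ne' (pt_snd_inj.1 h)
    have h4 := invLen_lt_mul_swap (x := x * Equiv.swap a b) (a := a) (b := b)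
      (by rwa [pt_mul_swap_left, pt_mul_swap_right])
      (by rwa [pt_mul_swap_left, pt_mul_swap_right])
    rw [mul_assoc, Equiv.swap_mul_self, mul_one] at h4
    exact h4.not_gt h.2.1

lemma swap_mem_R_iff (hx : bruhatLE x w) :
    Equiv.swap a b ∈ R x w ↔
      Edge (ht x w) (pt x a) (pt x b) ∨ Edge (ht x w) (pt x b) (pt x a) := by
  have key : ∀ {a b : Fin n}, Edge (ht x w) (pt x a) (pt x b) → a < b := fun h => by
    simpa [pt] using h.1
  rcases lt_trichotomy a b with h | rfl | h
  · rw [swap_mem_R hx h, or_iff_left fun h' => (key h').not_gt h]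
  · refine iff_of_false (fun h => ?_) (by simp [Edge])
    have := h.2.1
    rw [Equiv.swap_self, ← Equiv.Perm.one_def, mul_one] at this
    exact this.false
  · rw [Equiv.swap_comm, swap_mem_R hx h, or_iff_right fun h' => (key h').not_gt h]

lemma ncard_eq_sum_ind {α : Type*} [Fintype α] (p : α → Prop) :
    (({i | p i}.ncard : ℕ) : ℤ) = ∑ i, ind (p i) := by
  rw [Set.ncard_eq_toFinset_card', Set.toFinset_ofPred, card_filter_eq_sum_ind]

lemma ncard_R (hx : bruhatLE x w) :
    ((R x w).ncard : ℤ) = ∑ i, ∑ j, ind (Edge (ht x w) (pt x i) (pt x j)) := by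
  have lt_of_edge : ∀ {a b : Fin n}, Edge (ht x w) (pt x a) (pt x b) → a < b := fun h => by
    simpa [pt] using h.1
  have h1 : R x w = (fun T : Fin n × Fin n => Equiv.swap T.1 T.2) ''
      {T | Edge (ht x w) (pt x T.1) (pt x T.2)} := by
    ext t
    constructor
    · intro h
      obtain ⟨a, b, -, rfl⟩ := h.1
      rcases (swap_mem_R_iff hx).1 h with h' | h'
      · exact ⟨(a, b), h', rfl⟩
      · exact ⟨(b, a), h', Equiv.swap_comm b a⟩
    · rintro ⟨⟨a, b⟩, h, rfl⟩
      exact (swap_mem_R_iff hx).2 (Or.inl h)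
  rw [h1, Set.InjOn.ncard_image, ncard_eq_sum_ind, Fintype.sum_prod_type]
  rintro ⟨a, b⟩ h ⟨c, d⟩ h' hs
  have hab := lt_of_edge h
  have hcd := lt_of_edge h'
  have e1 := Equiv.congr_fun hs a
  have e2 := Equiv.congr_fun hs b
  dsimp only at e1 e2 hab hcd
  rw [Equiv.swap_apply_left, Equiv.swap_apply_def] at e1
  rw [Equiv.swap_apply_right, Equiv.swap_apply_def] at e2
  grind

lemma ncard_incompEdges (x : Equiv.Perm (Fin n)) (D : ℤ → ℤ → ℤ) (A B : ℤ × ℤ) :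
    ((incompEdges (Set.range (pt x)) D A B).ncard : ℤ) =
      ∑ i, ∑ j, ind (Edge D (pt x i) (pt x j) ∧ Incomp D A B (pt x i) (pt x j)) := by
  have h1 : incompEdges (Set.range (pt x)) D A B = Prod.map (pt x) (pt x) ''
      {T : Fin n × Fin n | Edge D (pt x T.1) (pt x T.2) ∧ Incomp D A B (pt x T.1) (pt x T.2)} := by
    ext ⟨C, E⟩
    constructor
    · rintro ⟨⟨i, rfl⟩, ⟨j, rfl⟩, h⟩
      exact ⟨(i, j), h, rfl⟩
    · rintro ⟨⟨i, j⟩, h, h'⟩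
      simp only [Prod.map_apply, Prod.mk.injEq] at h'
      obtain ⟨rfl, rfl⟩ := h'
      exact ⟨⟨i, rfl⟩, ⟨j, rfl⟩, h⟩
  rw [h1, Set.ncard_image_of_injective _ ((pt_injective x).prodMap (pt_injective x)),
    ncard_eq_sum_ind, Fintype.sum_prod_type]

/-- The excess `#R(x,w) - (l(w) - l(x))`. -/
noncomputable def excess (x w : Equiv.Perm (Fin n)) : ℤ :=
  (R x w).ncard - ((invLen w : ℤ) - invLen x)

lemma bruhatLE_mul_swap (hx : bruhatLE x w) (h : Edge (ht x w) (pt x a) (pt x b)) :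
    bruhatLE (x * Equiv.swap a b) w :=
  ((swap_mem_R_iff hx).2 (Or.inl h)).2.2

/-- Multiplying by a transposition in `R(x,w)` lowers the excess by the number of transpositions
incompatible with it. -/
theorem excess_eq_add (hx : bruhatLE x w) (h : Edge (ht x w) (pt x a) (pt x b)) :
    excess x w = excess (x * Equiv.swap a b) w +
      (incompEdges (Set.range (pt x)) (ht x w) (pt x a) (pt x b)).ncard := by
  have hab : a ≠ b := by rintro rfl; exact h.1.false
  have hx' := bruhatLE_mul_swap hx h
  set y := x * Equiv.swap a b with hy
  have key : ∑ i, ∑ j, (ind (Edge (ht x w) (pt x i) (pt x j)) -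
      ind (Edge (ht y w) (pt y i) (pt y j)) -
      (ind (Inv (pt y i) (pt y j)) - ind (Inv (pt x i) (pt x j))) -
      ind (Edge (ht x w) (pt x i) (pt x j) ∧
        Incomp (ht x w) (pt x a) (pt x b) (pt x i) (pt x j))) = 0 := by
    rw [sum_sum_eq_of_eq_zero _ hab]
    · rw [hy, ht_mul_swap x w h.1 h.2.1, pt_mul_swap_left, pt_mul_swap_right]
      rw [Finset.sum_eq_zero, add_zero]
      swap
      · intro c hc
        simp only [Finset.mem_compl, Finset.mem_insert, Finset.mem_singleton, not_or] at hc
        obtain ⟨e1, e2, e3, e4⟩ :=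
          edge_lower_third (D := ht x w) (A := pt x a) (B := pt x b) (C := pt x c)
        have e5 := edge_swap_third h (mt pt_fst_inj.1 hc.1) (mt pt_fst_inj.1 hc.2)
          (mt pt_snd_inj.1 hc.1) (mt pt_snd_inj.1 hc.2)
        have e6 := incomp_third (C := pt x c) h
        rw [pt_mul_swap_of_ne x hc.1 hc.2, e1, e2, e3, e4]
        linarith
      have f1 : ind (Edge (ht x w) (pt x a) (pt x b)) = 1 := ind_true h
      have f2 : ind (Inv ((pt x a).1, (pt x b).2) ((pt x b).1, (pt x a).2)) = 1 :=
        ind_true ⟨h.1, h.2.1⟩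
      have h1 := h.1
      have h2 := h.2.1
      have f3 : ¬ (Edge (ht x w) (pt x a) (pt x b) ∧
          Incomp (ht x w) (pt x a) (pt x b) (pt x a) (pt x b)) := by
        rintro ⟨-, h | ⟨h, -⟩ | ⟨h, -⟩⟩
        · exact h.1 rfl
        · rw [h] at h1
          exact h1.false
        · rw [h] at h1
          exact h1.false
      rw [f1, f2, ind_false f3]
      simp [Edge, Inv, h1.not_gt, h2.not_gt, ind_false, h1, h2]
    · intro i j h1 h2 h3 h4
      rw [pt_mul_swap_of_ne x h1 h2, pt_mul_swap_of_ne x h3 h4, hy, ht_mul_swap x w h.1 h.2.1,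
        edge_lower_other ((pt_injective x).ne h1) ((pt_injective x).ne h2)
          ((pt_injective x).ne h3) ((pt_injective x).ne h4)]
      ring
  simp only [Finset.sum_sub_distrib] at key
  rw [← ncard_R hx, ← ncard_R hx', ← invLen_eq_sum, ← invLen_eq_sum, ← ncard_incompEdges] at key
  unfold excess
  linarith

end Bruhat

section Main

variable {n : ℕ} {x w : Equiv.Perm (Fin n)}

lemma invLen_le (x : Equiv.Perm (Fin n)) : invLen x ≤ n * n := by
  simpa [invLen] using Finset.card_le_univ
    (Finset.univ.filter (fun p : Fin n × Fin n => p.1 < p.2 ∧ x p.2 < x p.1))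

/-- If `x < w` in the Bruhat order, then `R(x,w)` is nonempty. -/
lemma exists_edge (hx : bruhatLE x w) (hne : x ≠ w) :
    ∃ a b, Edge (ht x w) (pt x a) (pt x b) := by
  rw [bruhatLE_iff] at hx
  obtain ⟨i, hi, himin⟩ : ∃ i, x i ≠ w i ∧ ∀ k < i, x k = w k := by
    have h1 : (Finset.univ.filter fun i => x i ≠ w i).Nonempty := by
      by_contra h
      refine hne (Equiv.ext fun i => ?_)
      by_contra h'
      exact h ⟨i, by simpa using h'⟩
    refine ⟨_, (Finset.mem_filter.1 (Finset.min'_mem _ h1)).2, fun k hk => ?_⟩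
    by_contra h'
    exact (Finset.min'_le _ k (by simpa using h')).not_gt hk
  have hxw : x i < w i := by
    refine lt_of_le_of_ne (not_lt.1 fun hlt => ?_) hi
    have h1 := hx (i : ℕ) (w i : ℕ)
    rw [ht_eq_sum] at h1
    have h2 : ∑ k, (ind ((pt w k).1 ≤ ((i : ℕ) : ℤ) ∧ ((w i : ℕ) : ℤ) < (pt w k).2) -
      ind ((pt x k).1 ≤ ((i : ℕ) : ℤ) ∧ ((w i : ℕ) : ℤ) < (pt x k).2)) < ∑ k : Fin n, 0 := by
      refine Finset.sum_lt_sum (fun k _ => ?_) ⟨i, Finset.mem_univ _, ?_⟩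
      · rcases lt_trichotomy k i with hk | rfl | hk
        · simp [pt, himin k hk]
        · simp [pt, ind, hlt]
        · simp [pt, ind, hk.not_ge]
      · simp [pt, ind, hlt]
    simp only [Finset.sum_const_zero] at h2
    omega
  obtain ⟨j, ⟨hij, hj1, hj2⟩, hjmin⟩ : ∃ j, (i < j ∧ x i < x j ∧ x j ≤ w i) ∧
      ∀ k, i < k → k < j → x i < x k → w i < x k := by
    have h1 : (Finset.univ.filter fun j => i < j ∧ x i < x j ∧ x j ≤ w i).Nonempty := by
      refine ⟨x.symm (w i), ?_⟩
      rw [Finset.mem_filter, Equiv.apply_symm_apply]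
      refine ⟨Finset.mem_univ _, not_le.1 fun hle => ?_, hxw, le_rfl⟩
      rcases hle.lt_or_eq with h | h
      · have h2 := himin _ h
        rw [Equiv.apply_symm_apply] at h2
        exact h.ne (w.injective h2).symm
      · rw [← h, Equiv.apply_symm_apply] at hxw
        rw [h] at hxw
        exact hxw.false
    refine ⟨_, (Finset.mem_filter.1 (Finset.min'_mem _ h1)).2, fun k h2 h3 h4 => ?_⟩
    by_contra h'
    exact (Finset.min'_le _ k (by simpa using ⟨h2, h4, not_lt.1 h'⟩)).not_gt h3
  refine ⟨i, j, by simpa [pt] using hij, by simpa [pt] using hj1, fun p q hpq => ?_⟩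
  have h1 := hx p (w i : ℕ)
  suffices h : 0 < ht x w p q - ht x w p (w i : ℕ) by omega
  rw [ht_eq_sum, ht_eq_sum, ← Finset.sum_sub_distrib]
  simp only [InBox, pt] at hpq
  have hq : q < ((w i : ℕ) : ℤ) := by
    have : (x j : ℕ) ≤ (w i : ℕ) := hj2
    omega
  have hxw' : ((x i : ℕ) : ℤ) < ((w i : ℕ) : ℤ) := by exact_mod_cast hxw
  refine Finset.sum_pos' (fun k _ => ?_) ⟨i, Finset.mem_univ _, ?_⟩
  · rcases lt_trichotomy k i with hk | rfl | hk
    · simp [pt, himin k hk]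
    · simp only [ind, pt]
      split_ifs <;> omega
    · by_cases hkj : k < j
      · have h2 : x k ≤ x i ∨ w i < x k := by
          by_contra! h
          exact (hjmin k hk hkj h.1).not_ge h.2
        have h3 : ((x k : ℕ) : ℤ) ≤ ((x i : ℕ) : ℤ) ∨ ((w i : ℕ) : ℤ) < ((x k : ℕ) : ℤ) := by
          exact_mod_cast h2
        simp only [ind, pt]
        split_ifs <;> omega
      · have h2 : ((j : ℕ) : ℤ) ≤ ((k : ℕ) : ℤ) := by exact_mod_cast not_lt.1 hkj
        simp only [ind, pt]
        split_ifs <;> omega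
  · simp only [ind, pt]
    split_ifs <;> omega

/-- Deodhar's inequality. -/
theorem excess_nonneg (x w : Equiv.Perm (Fin n)) (hx : bruhatLE x w) : 0 ≤ excess x w := by
  induction h : n * n - invLen x using Nat.strong_induction_on generalizing x with
  | _ k ih =>
    by_cases hne : x = w
    · subst hne
      simp [excess]
    · obtain ⟨a, b, hab⟩ := exists_edge hx hne
      have h1 := excess_eq_add hx hab
      have h2 := invLen_lt_mul_swap (x := x) hab.1 hab.2.1
      have h3 := invLen_le (x * Equiv.swap a b)
      have h4 := ih _ (by omega) _ (bruhatLE_mul_swap hx hab) rfl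
      omega

lemma range_pt_mul_swap (x : Equiv.Perm (Fin n)) {a b : Fin n} :
    Set.range (pt (x * Equiv.swap a b)) = swapPts (Set.range (pt x)) (pt x a) (pt x b) := by
  ext P
  constructor
  · rintro ⟨c, rfl⟩
    by_cases h1 : c = a
    · subst h1
      exact Or.inr (Or.inl (pt_mul_swap_left x c b))
    by_cases h2 : c = b
    · subst h2
      exact Or.inr (Or.inr (pt_mul_swap_right x a c))
    rw [pt_mul_swap_of_ne x h1 h2]
    exact Or.inl ⟨⟨c, rfl⟩, (pt_injective x).ne h1, (pt_injective x).ne h2⟩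
  · rintro (⟨⟨c, rfl⟩, h1, h2⟩ | rfl | rfl)
    · exact ⟨c, pt_mul_swap_of_ne x (fun h => h1 (by rw [h])) (fun h => h2 (by rw [h]))⟩
    · exact ⟨a, pt_mul_swap_left x a b⟩
    · exact ⟨b, pt_mul_swap_right x a b⟩

theorem MSP.isMaxSing (h : MSP x w) : IsMaxSing (Set.range (pt x)) (ht x w) where
  fin := Set.finite_range _
  inj_fst := by
    rintro _ ⟨i, rfl⟩ _ ⟨j, rfl⟩ h
    rw [pt_fst_inj.1 h]
  inj_snd := by
    rintro _ ⟨i, rfl⟩ _ ⟨j, rfl⟩ h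
    rw [pt_snd_inj.1 h]
  nonneg := bruhatLE_iff.1 h.1
  regular := by
    refine ⟨(excess x w).toNat, ?_, ?_⟩
    · have := h.2.1
      simp only [excess, Int.lt_toNat]
      push_cast
      linarith
    · rintro _ ⟨a, rfl⟩ _ ⟨b, rfl⟩ hab
      have h1 := h.2.2 _ ((swap_mem_R_iff h.1).2 (Or.inl hab))
      have h2 := excess_eq_add h.1 hab
      have h3 : excess (x * Equiv.swap a b) w = 0 := by
        rw [excess, h1, sub_self]
      omega
  compat := by
    rintro _ ⟨a, rfl⟩ _ ⟨b, rfl⟩ hab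
    rw [← range_pt_mul_swap, ← ht_mul_swap x w hab.1 hab.2.1]
    rintro _ ⟨c, rfl⟩ _ ⟨d, rfl⟩ _ ⟨e, rfl⟩ _ ⟨f, rfl⟩ hcd hef hI
    have hy := bruhatLE_mul_swap h.1 hab
    have h1 := h.2.2 _ ((swap_mem_R_iff h.1).2 (Or.inl hab))
    have h2 := excess_eq_add hy hcd
    have h3 : excess (x * Equiv.swap a b) w = 0 := by
      rw [excess, h1, sub_self]
    have h4 := excess_nonneg _ w (bruhatLE_mul_swap hy hcd)
    have h5 : 0 < (incompEdges (Set.range (pt (x * Equiv.swap a b))) (ht (x * Equiv.swap a b) w)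
        (pt (x * Equiv.swap a b) c) (pt (x * Equiv.swap a b) d)).ncard := by
      refine (Set.ncard_pos ?_).2 ⟨(_, _), ⟨e, rfl⟩, ⟨f, rfl⟩, hef, hI⟩
      exact ((Set.finite_range _).prod (Set.finite_range _)).subset fun T hT => ⟨hT.1, hT.2.1⟩
    omega
  box p₁ p₂ q₁ q₂ hp hq := by
    have h1 : {P ∈ Set.range (pt x) | p₁ < P.1 ∧ P.1 ≤ p₂ ∧ q₁ < P.2 ∧ P.2 ≤ q₂} =
        pt x '' {k | p₁ < (pt x k).1 ∧ (pt x k).1 ≤ p₂ ∧ q₁ < (pt x k).2 ∧ (pt x k).2 ≤ q₂} := by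
      ext P
      constructor
      · rintro ⟨⟨k, rfl⟩, h⟩
        exact ⟨k, h, rfl⟩
      · rintro ⟨k, h, rfl⟩
        exact ⟨⟨k, rfl⟩, h⟩
    rw [h1, Set.ncard_image_of_injective _ (pt_injective x), ncard_eq_sum_ind, ht_eq_sum, ht_eq_sum,
      ht_eq_sum, ht_eq_sum, ← Finset.sum_sub_distrib, ← Finset.sum_sub_distrib,
      ← Finset.sum_add_distrib, ← Finset.sum_neg_distrib]
    refine Finset.sum_le_sum fun k _ => ?_
    simp only [ind]
    split_ifs <;> omega

end Main

/-- If `x` is an MSP for `w`, then the flattening `x̃` of `x` along `Δ(x,w)` avoids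
the pattern `1234`. -/
theorem msp_flattening_avoids_1234 {n K : ℕ} (x w : Equiv.Perm (Fin n))
    (hmsp : MSP x w) (hK : (DeltaFinset x w).card = K)
    (xt : Equiv.Perm (Fin K)) (hxt : IsFlatteningOn x (DeltaFinset x w) hK xt) :
    ¬ ∃ a b c d : Fin K, a < b ∧ b < c ∧ c < d ∧
      xt a < xt b ∧ xt b < xt c ∧ xt c < xt d := by
  rintro ⟨a, b, c, d, hab, hbc, hcd, hab', hbc', hcd'⟩
  set f := (DeltaFinset x w).orderIsoOfFin hK
  have endpoint : ∀ e : Fin K, ∃ P ∈ Set.range (pt x),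
      Edge (ht x w) (pt x (f e)) P ∨ Edge (ht x w) P (pt x (f e)) := by
    intro e
    have h : (f e : Fin n) ∈ Delta x w := by simpa [DeltaFinset] using (f e).2
    obtain ⟨j, hj⟩ := h
    exact ⟨pt x j, ⟨j, rfl⟩, (swap_mem_R_iff hmsp.1).1 hj⟩
  have fst_lt : ∀ {e e' : Fin K}, e < e' → (pt x (f e)).1 < (pt x (f e')).1 := fun h => by
    simpa [pt] using f.strictMono h
  have snd_lt : ∀ {e e' : Fin K}, xt e < xt e' → (pt x (f e)).2 < (pt x (f e')).2 := fun h =>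
    Int.ofNat_lt.2 ((hxt _ _).1 h)
  exact hmsp.isMaxSing.no_chain ⟨_, rfl⟩ ⟨_, rfl⟩ ⟨_, rfl⟩ ⟨_, rfl⟩ (endpoint a) (endpoint b)
    (endpoint c) (endpoint d) (fst_lt hab) (snd_lt hab') (fst_lt hbc) (snd_lt hbc') (fst_lt hcd)
    (snd_lt hcd')

end BSW
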